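/- Let k, l, m, n be integers, not all even. Define Q(x,y) = 2(kx+my)² + 2(lx+ny)² + 8xy and assume Q(x,y) > 0 for all integers (x,y) ≠ (0,0). Set A = 2k² + 2l², B = 8 + 4km + 4ln, C = 2m² + 2n², and let h = gcd(A, B, C). Then there exist integers x and y such that Q(x,y) = h·p for some prime p with p ≡ 1 (mod 4). -/

import Mathlib

namespace Weber

lemma summable_gauss_shift {a : ℝ} (ha : 0 < a) (δ : ℝ) :
    Summable (fun m : ℤ => Real.exp (-a * (m + δ) ^ 2)) := by
  have h := (summable_jacobiTheta₂_term_iff (Complex.I * (a * δ / Real.pi : ℝ))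
    (Complex.I * (a / Real.pi : ℝ))).mpr (by simp; positivity)
  have h2 := (h.norm).mul_left (Real.exp (-a * δ ^ 2))
  refine h2.congr fun m => ?_
  rw [norm_jacobiTheta₂_term, ← Real.exp_add]
  congr 1
  simp
  field_simp
  ring

/-- Poisson summation for a shifted Gaussian. -/
lemma gauss_shift_bound {a : ℝ} (ha : 0 < a) :
    ∃ C : ℝ, 0 ≤ C ∧ ∀ t : ℝ, 0 < t → ∀ δ : ℝ,
      |∑' m : ℤ, Real.exp (-(t * a) * (m + δ) ^ 2) - √(Real.pi / (t * a))| ≤ C * √t := by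
  have hs : Summable (fun n : ℤ => (1 : ℝ) / (n : ℝ) ^ 2) :=
    Real.summable_one_div_int_pow.mpr (by norm_num)
  set S := ∑' n : ℤ, (1 : ℝ) / (n : ℝ) ^ 2 with hS
  have hS0 : 0 ≤ S := tsum_nonneg fun n => by positivity
  refine ⟨√(a / Real.pi) * S / Real.pi, by positivity, fun t ht δ => ?_⟩
  set b : ℝ := t * a / Real.pi with hb
  have hpi := Real.pi_pos
  have hb0 : 0 < b := by positivity
  have key := Complex.tsum_exp_neg_quadratic (a := (b : ℂ)) (by simpa using hb0) (-(b * δ : ℝ) : ℂ)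
  -- real sum as complex
  have e1 : ((∑' m : ℤ, Real.exp (-(t * a) * (m + δ) ^ 2) : ℝ) : ℂ) =
      Complex.exp (-(Real.pi * b * δ ^ 2 : ℝ)) *
      ∑' (n : ℤ), Complex.exp (-↑Real.pi * b * ↑n ^ 2 + 2 * ↑Real.pi * (-(b * δ : ℝ)) * ↑n) := by
    rw [Complex.ofReal_tsum, ← tsum_mul_left]
    congr 1; ext n
    rw [← Complex.exp_add, Complex.ofReal_exp]
    congr 1
    have : t * a = Real.pi * b := by rw [hb]; field_simp
    rw [this]; push_cast; ring
  have e2 : ((∑' m : ℤ, Real.exp (-(t * a) * (m + δ) ^ 2) : ℝ) : ℂ) =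
      ((1 / √b : ℝ) : ℂ) * ∑' n : ℤ, Complex.exp (-(Real.pi / b * n ^ 2 : ℝ)) *
        Complex.exp ((2 * Real.pi * δ * n : ℝ) * Complex.I) := by
    rw [e1, key, mul_left_comm, ← tsum_mul_left]
    congr 1
    · rw [Real.sqrt_eq_rpow]
      push_cast
      rw [Complex.ofReal_cpow hb0.le]; norm_num
    · congr 1; ext n
      rw [← Complex.exp_add, ← Complex.exp_add]
      congr 1
      have hbc : (b : ℂ) ≠ 0 := by exact_mod_cast hb0.ne'
      push_cast
      field_simp
      ring_nf
      simp [Complex.I_sq]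
  set f : ℤ → ℂ := fun n => Complex.exp (-(Real.pi / b * n ^ 2 : ℝ)) *
        Complex.exp ((2 * Real.pi * δ * n : ℝ) * Complex.I) with hf
  have hfn : ∀ n, ‖f n‖ = Real.exp (-(Real.pi / b * n ^ 2)) := by
    intro n
    rw [hf]; simp only [norm_mul, Complex.norm_exp_ofReal_mul_I, mul_one]
    rw [Complex.norm_exp]; simp only [Complex.neg_re, Complex.ofReal_re]
  have hf0 : f 0 = 1 := by simp [hf]
  have hbound : ∀ n : ℤ, n ≠ 0 → ‖f n‖ ≤ b / Real.pi * (1 / (n : ℝ) ^ 2) := by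
    intro n hn
    rw [hfn, Real.exp_neg]
    have hn2 : (0 : ℝ) < (n : ℝ) ^ 2 := by positivity
    have hx : 0 < Real.pi / b * n ^ 2 := by positivity
    have : Real.pi / b * n ^ 2 ≤ Real.exp (Real.pi / b * n ^ 2) := by
      linarith [Real.add_one_le_exp (Real.pi / b * n ^ 2)]
    calc _ ≤ (Real.pi / b * n ^ 2)⁻¹ := inv_anti₀ hx this
      _ = _ := by field_simp
  have hf' : ∀ n, ‖(if n = 0 then 0 else f n)‖ ≤ b / Real.pi * (1 / (n : ℝ) ^ 2) := by
    intro n; split_ifs with h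
    · simp [h]
    · exact hbound n h
  have hsum' : Summable (fun n => if n = 0 then 0 else f n) :=
    Summable.of_norm_bounded (hs.mul_left _) hf'
  have hsumf : Summable f := by
    rw [← summable_norm_iff]
    have := summable_gauss_shift (a := Real.pi / b) (by positivity) 0
    refine this.congr fun n => ?_
    rw [hfn]; simp
  have hsplit : ∑' n, f n = 1 + ∑' n, (if n = 0 then 0 else f n) := by
    rw [hsumf.tsum_eq_add_tsum_ite 0, hf0]
  have hmain : √(Real.pi / (t * a)) = 1 / √b := by
    rw [hb, ← Real.sqrt_one, ← Real.sqrt_div (by norm_num)]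
    congr 1; field_simp
  have hnorm : ‖∑' n, (if n = 0 then 0 else f n)‖ ≤ b / Real.pi * S := by
    refine (tsum_of_norm_bounded (hs.mul_left (b / Real.pi)).hasSum hf').trans ?_
    rw [tsum_mul_left]
  rw [← Real.norm_eq_abs, ← Complex.norm_real, Complex.ofReal_sub, e2, hsplit, hmain, mul_add, mul_one, add_sub_cancel_left,
    norm_mul, Complex.norm_real, Real.norm_of_nonneg (by positivity)]
  calc 1 / √b * _ ≤ 1 / √b * (b / Real.pi * S) := by gcongr
    _ = √b * S / Real.pi := by
      have : b = √b * √b := (Real.mul_self_sqrt hb0.le).symm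
      have h3 : √b ≠ 0 := by positivity
      nth_rw 2 [this]
      field_simp
    _ = _ := by
      rw [hb, show t * a / Real.pi = a / Real.pi * t by ring, Real.sqrt_mul (by positivity)]
      ring

set_option maxHeartbeats 1000000 in
/-- two-dimensional theta asymptotics -/
lemma theta2 (v e₁ e₂ : ℂ) (Δ : ℝ) (hΔ : Δ = |(e₂ * (starRingEnd ℂ) e₁).im|) (hΔ0 : 0 < Δ) :
    (∀ t : ℝ, 0 < t → Summable (fun z : ℤ × ℤ => Real.exp (-t * Complex.normSq (v + z.1 * e₁ + z.2 * e₂)))) ∧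
    ∃ C : ℝ, ∀ t : ℝ, 0 < t → t ≤ 1 →
      |∑' z : ℤ × ℤ, Real.exp (-t * Complex.normSq (v + z.1 * e₁ + z.2 * e₂)) - Real.pi / Δ / t| ≤ C := by
  set A := Complex.normSq e₁ with hA
  have he : e₁ ≠ 0 := by rintro rfl; simp at hΔ; linarith
  have hA0 : 0 < A := Complex.normSq_pos.mpr he
  set d := (e₂ * (starRingEnd ℂ) e₁).im with hd
  have hd0 : d ≠ 0 := by intro h; rw [h] at hΔ; simp at hΔ; linarith
  set B := Δ ^ 2 / A with hB
  have hΔd : Δ ^ 2 = d ^ 2 := by rw [hΔ, sq_abs]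
  have hB0 : 0 < B := by positivity
  set ε := (v * (starRingEnd ℂ) e₁).im / d with hε
  set δ : ℤ → ℝ := fun n => ((v + n * e₂) * (starRingEnd ℂ) e₁).re / A with hδ
  have hsq : ∀ z : ℤ × ℤ, Complex.normSq (v + z.1 * e₁ + z.2 * e₂) =
      A * (z.1 + δ z.2) ^ 2 + B * (z.2 + ε) ^ 2 := by
    rintro ⟨m, n⟩
    have h1 : B * (n + ε) ^ 2 = (((v + n * e₂) * (starRingEnd ℂ) e₁).im) ^ 2 / A := by
      have : ((v + n * e₂) * (starRingEnd ℂ) e₁).im = d * (n + ε) := by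
        rw [hε, mul_add, mul_div_cancel₀ _ hd0, hd]
        simp [add_mul]; ring
      rw [this, hB, hΔd]; ring
    simp only
    rw [h1]
    simp only [hδ]
    field_simp
    simp only [hA, Complex.normSq_apply]
    simp
    ring
  have hterm : ∀ t : ℝ, ∀ z : ℤ × ℤ, Real.exp (-t * Complex.normSq (v + z.1 * e₁ + z.2 * e₂)) =
      Real.exp (-(t * B) * (z.2 + ε) ^ 2) * Real.exp (-(t * A) * (z.1 + δ z.2) ^ 2) := by
    intro t z; rw [hsq, ← Real.exp_add]; congr 1; ring
  clear_value δ ε B d A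
  obtain ⟨C1, hC1, h1⟩ := gauss_shift_bound hA0
  obtain ⟨C2, hC2, h2⟩ := gauss_shift_bound hB0
  have hin : ∀ t : ℝ, 0 < t → ∀ n : ℤ, Summable (fun m : ℤ => Real.exp (-(t * A) * (m + δ n) ^ 2)) :=
    fun t ht n => summable_gauss_shift (by positivity) _
  have hout : ∀ t : ℝ, 0 < t → Summable (fun n : ℤ => Real.exp (-(t * B) * (n + ε) ^ 2)) :=
    fun t ht => summable_gauss_shift (by positivity) _
  set g : ℝ → ℤ → ℝ := fun t n => ∑' m : ℤ, Real.exp (-(t * A) * (m + δ n) ^ 2) with hg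
  have hgs : ∀ t : ℝ, 0 < t → Summable (fun n : ℤ => Real.exp (-(t * B) * (n + ε) ^ 2) * g t n) := by
    intro t ht
    refine Summable.of_nonneg_of_le (fun n => mul_nonneg (Real.exp_pos _).le
      (tsum_nonneg fun m => (Real.exp_pos _).le)) (fun n => ?_)
      ((hout t ht).mul_right (√(Real.pi / (t * A)) + C1 * √t))
    gcongr
    have := h1 t ht (δ n)
    rw [abs_le] at this
    simp only [hg]; linarith
  have hsw : ∀ t : ℝ, 0 < t → Summable (fun z : ℤ × ℤ => Real.exp (-(t * B) * (z.1 + ε) ^ 2) *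
      Real.exp (-(t * A) * (z.2 + δ z.1) ^ 2)) := by
    intro t ht
    rw [summable_prod_of_nonneg (fun z => by positivity)]
    refine ⟨fun n => (hin t ht n).mul_left (Real.exp (-(t * B) * (n + ε) ^ 2)), ?_⟩
    refine (hgs t ht).congr fun n => ?_
    simp only [hg, tsum_mul_left]
  refine ⟨fun t ht => ?_, ?_⟩
  · simp_rw [hterm]
    exact ((Equiv.prodComm ℤ ℤ).summable_iff.mpr (hsw t ht))
  refine ⟨√(Real.pi / A) * C2 + C1 * (√(Real.pi / B) + C2), fun t ht ht1 => ?_⟩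
  have hval : ∑' z : ℤ × ℤ, Real.exp (-t * Complex.normSq (v + z.1 * e₁ + z.2 * e₂)) =
      ∑' n : ℤ, Real.exp (-(t * B) * (n + ε) ^ 2) * g t n := by
    simp_rw [hterm]
    rw [← (Equiv.prodComm ℤ ℤ).tsum_eq]
    simp only [Equiv.prodComm_apply, Prod.fst_swap, Prod.snd_swap]
    rw [(hsw t ht).tsum_prod' (fun n => (hin t ht n).mul_left (Real.exp (-(t * B) * (n + ε) ^ 2)))]
    simp only [hg, tsum_mul_left]
  rw [hval]
  set E := ∑' n : ℤ, Real.exp (-(t * B) * (n + ε) ^ 2) with hE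
  have hE2 := h2 t ht ε
  rw [← hE] at hE2
  have hst : √t ≤ 1 := Real.sqrt_le_one.mpr ht1
  have hst0 : 0 < √t := by positivity
  have hdiff : |∑' n : ℤ, Real.exp (-(t * B) * (n + ε) ^ 2) * g t n - √(Real.pi / (t * A)) * E| ≤ C1 * √t * E := by
    rw [hE, ← tsum_mul_left, ← (hgs t ht).tsum_sub ((hout t ht).mul_left _), ← tsum_mul_left, ← Real.norm_eq_abs]
    refine tsum_of_norm_bounded (((hout t ht).mul_left _).hasSum) fun n => ?_
    rw [show ∀ a b c : ℝ, a * b - c * a = a * (b - c) by intros; ring, norm_mul, Real.norm_of_nonneg (Real.exp_pos _).le,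
      mul_comm]
    gcongr
    exact h1 t ht (δ n)
  have sA : √(Real.pi / (t * A)) = √(Real.pi / A) / √t := by
    rw [← Real.sqrt_div (by positivity)]; congr 1; field_simp
  have sB : √(Real.pi / (t * B)) = √(Real.pi / B) / √t := by
    rw [← Real.sqrt_div (by positivity)]; congr 1; field_simp
  have hprod : √(Real.pi / A) * √(Real.pi / B) = Real.pi / Δ := by
    rw [← Real.sqrt_mul (by positivity)]
    rw [show Real.pi / A * (Real.pi / B) = (Real.pi / Δ) ^ 2 by rw [hB]; field_simp]
    exact Real.sqrt_sq (by positivity)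
  have htt : √t * √t = t := Real.mul_self_sqrt ht.le
  rw [sB] at hE2
  rw [sA] at hdiff
  have hmain : Real.pi / Δ / t = √(Real.pi / A) / √t * (√(Real.pi / B) / √t) := by
    rw [← hprod, div_mul_div_comm, htt]
  have q1 : |√(Real.pi / A) / √t * E - Real.pi / Δ / t| ≤ √(Real.pi / A) * C2 := by
    rw [hmain, ← mul_sub, abs_mul, abs_of_nonneg (by positivity)]
    calc _ ≤ √(Real.pi / A) / √t * (C2 * √t) := by gcongr
      _ = _ := by field_simp
  have q2 : C1 * √t * E ≤ C1 * (√(Real.pi / B) + C2) := by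
    rw [mul_assoc]
    gcongr
    have : E ≤ √(Real.pi / B) / √t + C2 * √t := by rw [abs_le] at hE2; linarith
    calc √t * E ≤ √t * (√(Real.pi / B) / √t + C2 * √t) := by gcongr
      _ = √(Real.pi / B) + C2 * (√t * √t) := by field_simp
      _ ≤ _ := by rw [htt]; nlinarith
  calc _ ≤ _ + _ := abs_sub_le _ (√(Real.pi / A) / √t * E) _
    _ ≤ _ := by linarith

end Weber


namespace Weber

open Filter Topology

section Euler
variable {R : Type*} [CommMonoidWithZero R] [UniqueFactorizationMonoid R] [Subsingleton Rˣ]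

/-- elements all of whose prime divisors are in S -/
def smooth (S : Finset {p : R // Prime p}) : Set R :=
  {a | a ≠ 0 ∧ ∀ p : {p : R // Prime p}, p.1 ∣ a → p ∈ S}

lemma smooth_empty [Nontrivial R] : smooth (∅ : Finset {p : R // Prime p}) = {1} := by
  ext a
  simp only [smooth, Set.mem_ofPred_eq, Finset.notMem_empty, imp_false, Set.mem_singleton_iff]
  constructor
  · rintro ⟨h0, h⟩
    by_contra h1
    have hu : ¬ IsUnit a := fun hu => h1 (by
      obtain ⟨u, rfl⟩ := hu
      rw [Subsingleton.elim u 1]; simp)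
    obtain ⟨q, hq, hqa⟩ := WfDvdMonoid.exists_irreducible_factor hu h0
    exact h ⟨q, UniqueFactorizationMonoid.irreducible_iff_prime.mp hq⟩ hqa
  · rintro rfl
    refine ⟨one_ne_zero, fun p hp => p.2.not_isUnit (isUnit_of_dvd_one hp)⟩

lemma prime_eq_of_dvd {p q : R} (hp : Prime p) (hq : Prime q) (h : p ∣ q) : p = q := by
  have := (hp.dvd_prime_iff_associated hq).mp h
  obtain ⟨u, hu⟩ := this
  rw [Subsingleton.elim u 1] at hu; simpa using hu

open Classical in
/-- inserting a prime -/
noncomputable def smoothInsert (S : Finset {p : R // Prime p}) (p : {p : R // Prime p}) (hp : p ∉ S) :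
    ℕ × smooth S ≃ smooth (insert p S) := by
  refine Equiv.ofBijective (fun x => ⟨p.1 ^ x.1 * x.2.1, ?_, ?_⟩) ⟨?_, ?_⟩
  · have := x.2.2.1
    have h0 := p.2.ne_zero
    exact mul_ne_zero (pow_ne_zero _ h0) this
  · intro q hq
    rcases q.2.dvd_or_dvd hq with h | h
    · have := q.2.dvd_of_dvd_pow h
      have : q = p := Subtype.ext (prime_eq_of_dvd q.2 p.2 this)
      simp [this]
    · exact Finset.mem_insert_of_mem (x.2.2.2 q h)
  · rintro ⟨k, a, ha⟩ ⟨j, b, hb⟩ h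
    have h' : p.1 ^ k * a = p.1 ^ j * b := congrArg Subtype.val h
    have hpa : ¬ p.1 ∣ a := fun h => hp (ha.2 p h)
    have hpb : ¬ p.1 ∣ b := fun h => hp (hb.2 p h)
    have key : ∀ (k j : ℕ) (a b : R), p.1 ^ k * a = p.1 ^ j * b → ¬ p.1 ∣ b → j ≤ k → k = j ∧ a = b := by
      intro k j a b h hpb hjk
      obtain ⟨i, rfl⟩ := Nat.exists_eq_add_of_le hjk
      rw [pow_add, mul_assoc] at h
      have h2 := mul_left_cancel₀ (pow_ne_zero _ p.2.ne_zero) h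
      rcases Nat.eq_zero_or_pos i with rfl | hi
      · simpa using h2
      · exact absurd (h2 ▸ dvd_mul_of_dvd_left (dvd_pow_self _ hi.ne') _) hpb
    rcases le_total j k with hjk | hjk
    · obtain ⟨rfl, rfl⟩ := key k j a b h' hpb hjk; rfl
    · obtain ⟨rfl, rfl⟩ := key j k b a h'.symm hpa hjk; rfl
  · rintro ⟨a, ha0, ha⟩
    obtain ⟨n, c, hc, rfl⟩ := WfDvdMonoid.max_power_factor ha0 (p.2.irreducible)
    refine ⟨⟨n, c, ?_, ?_⟩, rfl⟩
    · exact right_ne_zero_of_mul ha0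
    · intro q hq
      have := ha q (dvd_mul_of_dvd_right hq _)
      rcases Finset.mem_insert.mp this with rfl | h
      · exact absurd hq hc
      · exact h

variable [Nontrivial R]

lemma norm_lt_one_of_summable {f : R →*₀ ℂ} (hf : Summable (fun a => ‖f a‖)) (p : {p : R // Prime p}) :
    ‖f p.1‖ < 1 := by
  have hinj : Function.Injective (fun k : ℕ => p.1 ^ k) := by
    have key : ∀ i j : ℕ, p.1 ^ i = p.1 ^ (i + j) → j = 0 := by
      intro i j h
      by_contra hj
      rw [pow_add] at h
      have h2 := mul_left_cancel₀ (pow_ne_zero i p.2.ne_zero) ((mul_one _).trans h)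
      exact p.2.not_isUnit (isUnit_of_dvd_one (h2 ▸ dvd_pow_self _ hj))
    intro i j h
    simp only at h
    rcases le_total i j with hij | hij
    · obtain ⟨k, rfl⟩ := Nat.exists_eq_add_of_le hij
      have := key _ _ h; omega
    · obtain ⟨k, rfl⟩ := Nat.exists_eq_add_of_le hij
      have := key _ _ h.symm; omega
  have := hf.comp_injective hinj
  simp only [Function.comp_def, map_pow, norm_pow] at this
  simpa using summable_geometric_iff_norm_lt_one.mp this

lemma hasSum_smooth {f : R →*₀ ℂ} (hf : Summable (fun a => ‖f a‖)) (S : Finset {p : R // Prime p}) :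
    HasSum (fun a : smooth S => f a) (∏ p ∈ S, (1 - f p.1)⁻¹) := by
  classical
  induction S using Finset.induction_on with
  | empty =>
    rw [Finset.prod_empty]
    have : HasSum (fun a : ({1} : Set R) => f a) 1 := by
      have := hasSum_unique (fun a : ({1} : Set R) => f a)
      simpa using this
    rw [smooth_empty]; exact this
  | insert p S hp ih =>
    rw [Finset.prod_insert hp, ← (smoothInsert S p hp).hasSum_iff]
    have h1 : HasSum (fun k : ℕ => f p.1 ^ k) (1 - f p.1)⁻¹ :=
      hasSum_geometric_of_norm_lt_one (norm_lt_one_of_summable hf p)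
    have hs := hf.comp_injective (i := fun x : ℕ × smooth S => (smoothInsert S p hp x).1)
      (Subtype.val_injective.comp (smoothInsert S p hp).injective)
    have e : ∀ x : ℕ × smooth S, f ((smoothInsert S p hp x).1) = f p.1 ^ x.1 * f x.2.1 := by
      intro x
      change f (p.1 ^ x.1 * x.2.1) = _
      rw [map_mul, map_pow]
    have := h1.mul ih (by
      have := hs.of_norm
      simpa only [Function.comp_def, e] using this)
    simpa only [Function.comp_def, e] using this

theorem euler_exp {f : R →*₀ ℂ} (hf : Summable (fun a => ‖f a‖)) :
    Complex.exp (∑' p : {p : R // Prime p}, -Complex.log (1 - f p.1)) = ∑' a, f a := by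
  classical
  have hsp : Summable (fun p : {p : R // Prime p} => f p.1) :=
    (hf.comp_injective Subtype.val_injective).of_norm
  have hl := (hsp.clog_one_sub).neg
  have t1 : Tendsto (fun S : Finset {p : R // Prime p} => Complex.exp (∑ p ∈ S, -Complex.log (1 - f p.1)))
      atTop (𝓝 (Complex.exp (∑' p : {p : R // Prime p}, -Complex.log (1 - f p.1)))) :=
    (Complex.continuous_exp.tendsto _).comp hl.hasSum
  have t2 : Tendsto (fun S : Finset {p : R // Prime p} => ∑' a, (smooth S).indicator (fun a => f a) a)
      atTop (𝓝 (∑' a, f a)) := by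
    refine tendsto_tsum_of_dominated_convergence hf (fun a => ?_) (Eventually.of_forall fun S a => ?_)
    · by_cases ha : a = 0
      · subst ha
        refine tendsto_const_nhds.congr fun S => ?_
        simp [Set.indicator]
      · have hfin : {p : {p : R // Prime p} | p.1 ∣ a}.Finite := by
          have : {p : R | p ∈ UniqueFactorizationMonoid.factors a}.Finite :=
            (UniqueFactorizationMonoid.factors a).toFinset.finite_toSet.subset (fun x hx => Multiset.mem_toFinset.mpr hx)
          refine Set.Finite.of_finite_image (f := Subtype.val) (this.subset ?_) Subtype.val_injective.injOn
          rintro _ ⟨p, hp, rfl⟩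
          obtain ⟨q, hq, hpq⟩ := UniqueFactorizationMonoid.exists_mem_factors_of_dvd ha p.2.irreducible hp
          have hq' := UniqueFactorizationMonoid.prime_of_factor q hq
          rw [prime_eq_of_dvd p.2 hq' hpq.dvd]; exact hq
        refine tendsto_const_nhds.congr' ?_
        filter_upwards [eventually_ge_atTop hfin.toFinset] with S hS
        rw [Set.indicator_of_mem]
        exact ⟨ha, fun p hp => hS (by simpa using hp)⟩
    · rw [norm_indicator_eq_indicator_norm]
      exact Set.indicator_le_self' (fun _ _ => norm_nonneg _) a
  refine tendsto_nhds_unique t1 (t2.congr fun S => ?_)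
  rw [← tsum_subtype, (hasSum_smooth hf S).tsum_eq, Complex.exp_sum]
  refine Finset.prod_congr rfl fun p _ => ?_
  rw [Complex.exp_neg, Complex.exp_log]
  intro h
  have h1 : f p.1 = 1 := (sub_eq_zero.mp h).symm
  have := norm_lt_one_of_summable hf p
  rw [h1] at this; simp at this
end Euler
end Weber


namespace Weber

open Filter Topology ComplexOrder

section DSum
variable {ι : Type*}

/-- coefficients of the Dirichlet series `∑ w i * m i ^ (-s)` -/
noncomputable def coef (w : ι → ℂ) (m : ι → ℕ) (n : ℕ) : ℂ := ∑' i : {i // m i = n}, w i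

lemma coef_aux (w : ι → ℂ) (m : ι → ℕ) (hm : ∀ i, m i ≠ 0) (s : ℂ)
    (h : Summable fun i => ‖w i‖ * (m i : ℝ) ^ (-s.re)) :
    LSeriesSummable (coef w m) s ∧ LSeries (coef w m) s = ∑' i, w i * (m i : ℂ) ^ (-s) := by
  have hn : Summable fun i => w i * (m i : ℂ) ^ (-s) := by
    refine Summable.of_norm (h.congr fun i => ?_)
    rw [norm_mul, Complex.norm_natCast_cpow_of_pos (Nat.pos_of_ne_zero (hm i)), Complex.neg_re]
  have hs := (Equiv.sigmaFiberEquiv m).summable_iff.mpr hn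
  have ht := (Equiv.sigmaFiberEquiv m).tsum_eq (fun i => w i * (m i : ℂ) ^ (-s))
  have e : (fun n : ℕ => ∑' i : {i // m i = n}, w i * (m i : ℂ) ^ (-s)) = LSeries.term (coef w m) s := by
    ext n
    rcases Nat.eq_zero_or_pos n with rfl | hn
    · rw [LSeries.term_zero]
      have : IsEmpty {i // m i = 0} := ⟨fun i => hm i.1 i.2⟩
      exact tsum_empty
    · rw [LSeries.term_of_ne_zero hn.ne', coef, ← tsum_div_const]
      congr 1; ext i
      rw [i.2, Complex.cpow_neg]; rfl
  constructor
  · have := hs.sigma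
    rw [LSeriesSummable, ← e]
    exact this
  · rw [← ht, LSeries, ← e]
    exact (hs.tsum_sigma).symm

lemma coef_abscissa (w : ι → ℂ) (m : ι → ℕ) (hm : ∀ i, m i ≠ 0) (σ : ℝ)
    (h : ∀ x : ℝ, σ < x → Summable fun i => ‖w i‖ * (m i : ℝ) ^ (-x)) :
    LSeries.abscissaOfAbsConv (coef w m) ≤ σ :=
  LSeries.abscissaOfAbsConv_le_of_forall_lt_LSeriesSummable fun y hy =>
    (coef_aux w m hm y (by simpa using h y hy)).1

/-- a Dirichlet sum -/
noncomputable def DS (w : ι → ℂ) (m : ι → ℕ) (s : ℂ) : ℂ := ∑' i, w i * (m i : ℂ) ^ (-s)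

lemma DS_eq (w : ι → ℂ) (m : ι → ℕ) (hm : ∀ i, m i ≠ 0) (σ : ℝ)
    (h : ∀ x : ℝ, σ < x → Summable fun i => ‖w i‖ * (m i : ℝ) ^ (-x)) {s : ℂ} (hs : σ < s.re) :
    DS w m s = LSeries (coef w m) s := ((coef_aux w m hm s (h _ hs)).2).symm

lemma isOpen_halfplane (σ : ℝ) : IsOpen {s : ℂ | σ < s.re} :=
  isOpen_lt continuous_const Complex.continuous_re

lemma DS_eventuallyEq (w : ι → ℂ) (m : ι → ℕ) (hm : ∀ i, m i ≠ 0) (σ : ℝ)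
    (h : ∀ x : ℝ, σ < x → Summable fun i => ‖w i‖ * (m i : ℝ) ^ (-x)) {s : ℂ} (hs : σ < s.re) :
    DS w m =ᶠ[𝓝 s] LSeries (coef w m) := by
  filter_upwards [(isOpen_halfplane σ).mem_nhds hs] with z hz
  exact DS_eq w m hm σ h hz

lemma DS_analyticAt (w : ι → ℂ) (m : ι → ℕ) (hm : ∀ i, m i ≠ 0) (σ : ℝ)
    (h : ∀ x : ℝ, σ < x → Summable fun i => ‖w i‖ * (m i : ℝ) ^ (-x)) {s : ℂ} (hs : σ < s.re) :
    AnalyticAt ℂ (DS w m) s := by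
  refine (LSeries_analyticOnNhd (coef w m) s ?_).congr (DS_eventuallyEq w m hm σ h hs).symm
  exact lt_of_le_of_lt (coef_abscissa w m hm σ h) (by exact_mod_cast hs)

/-- alternating derivatives at 2 -/
def CM (f : ℂ → ℂ) : Prop := ∀ n, 0 ≤ (-1) ^ n * iteratedDeriv n f 2

lemma DS_CM (w : ι → ℂ) (m : ι → ℕ) (hm : ∀ i, m i ≠ 0) (hw : ∀ i, 0 ≤ w i)
    (h : ∀ x : ℝ, 1 < x → Summable fun i => ‖w i‖ * (m i : ℝ) ^ (-x)) : CM (DS w m) := by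
  intro n
  have h2 : (1 : ℝ) < (2 : ℂ).re := by norm_num
  rw [(DS_eventuallyEq w m hm 1 h h2).iteratedDeriv_eq]
  have := LSeries.iteratedDeriv_alternating (a := coef w m) (fun n => tsum_nonneg fun i => hw i) (x := 2)
    (lt_of_le_of_lt (coef_abscissa w m hm 1 h) (by norm_cast)) n
  simpa using this

lemma leibniz_alt {f g : ℂ → ℂ} (hf : AnalyticAt ℂ f 2) (hg : AnalyticAt ℂ g 2) (n : ℕ)
    (h1 : ∀ i ≤ n, 0 ≤ (-1) ^ i * iteratedDeriv i f 2) (h2 : ∀ i ≤ n, 0 ≤ (-1) ^ i * iteratedDeriv i g 2) :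
    0 ≤ (-1) ^ n * iteratedDeriv n (f * g) 2 := by
  rw [iteratedDeriv_mul hf.contDiffAt hg.contDiffAt, Finset.mul_sum]
  refine Finset.sum_nonneg fun i hi => ?_
  have hi' : i ≤ n := by simpa [Nat.lt_succ_iff] using hi
  have e : (-1 : ℂ) ^ n * ((n.choose i : ℂ) * iteratedDeriv i f 2 * iteratedDeriv (n - i) g 2) =
      (n.choose i : ℂ) * (((-1) ^ i * iteratedDeriv i f 2) * ((-1) ^ (n - i) * iteratedDeriv (n - i) g 2)) := by
    obtain ⟨k, rfl⟩ := Nat.exists_eq_add_of_le hi'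
    rw [Nat.add_sub_cancel_left, pow_add]; ring
  rw [e]
  exact mul_nonneg (by exact_mod_cast Nat.zero_le _) (mul_nonneg (h1 i hi') (h2 _ (Nat.sub_le _ _)))

lemma deriv_exp_comp {D : ℂ → ℂ} (hD : AnalyticAt ℂ D 2) :
    deriv (fun s => Complex.exp (D s)) =ᶠ[𝓝 2] -((-deriv D) * fun s => Complex.exp (D s)) := by
  filter_upwards [hD.eventually_analyticAt] with s hs
  rw [(hs.differentiableAt.hasDerivAt.cexp).deriv]
  simp; ring

lemma CM_neg_deriv {D : ℂ → ℂ} (h : CM D) (n : ℕ) : 0 ≤ (-1) ^ n * iteratedDeriv n (-deriv D) 2 := by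
  have := h (n + 1)
  rw [iteratedDeriv_succ'] at this
  rw [iteratedDeriv_neg]
  simpa [pow_succ] using this

lemma CM_exp {D : ℂ → ℂ} (hD : AnalyticAt ℂ D 2) (h : CM D) : CM (fun s => Complex.exp (D s)) := by
  have hE : AnalyticAt ℂ (fun s => Complex.exp (D s)) 2 := hD.cexp
  intro n
  induction n using Nat.strong_induction_on with
  | _ n ih =>
    cases n with
    | zero =>
      simp only [pow_zero, iteratedDeriv_zero, one_mul]
      have h0 : 0 ≤ D 2 := by simpa using h 0
      have hre := Complex.eq_re_of_ofReal_le (r := 0) (by simpa using h0 : ((0 : ℝ) : ℂ) ≤ D 2)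
      rw [hre, ← Complex.ofReal_exp]
      exact_mod_cast (Real.exp_pos _).le
    | succ n =>
      rw [iteratedDeriv_succ', (deriv_exp_comp hD).iteratedDeriv_eq, iteratedDeriv_neg]
      have := leibniz_alt hD.deriv.neg hE n (fun i _ => CM_neg_deriv h i) (fun i hi => ih i (by omega))
      simpa [pow_succ] using this

lemma CM_exp_sub {D : ℂ → ℂ} (hD : AnalyticAt ℂ D 2) (h : CM D) : CM (fun s => Complex.exp (D s) - D s) := by
  have hE : AnalyticAt ℂ (fun s => Complex.exp (D s)) 2 := hD.cexp
  have h0 : 0 ≤ D 2 := by simpa using h 0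
  have hre := Complex.eq_re_of_ofReal_le (r := 0) (by simpa using h0 : ((0 : ℝ) : ℂ) ≤ D 2)
  have hr0 : 0 ≤ (D 2).re := (Complex.nonneg_iff.mp h0).1
  intro n
  cases n with
  | zero =>
    simp only [pow_zero, iteratedDeriv_zero, one_mul]
    rw [hre, ← Complex.ofReal_exp, ← Complex.ofReal_sub]
    have := Real.add_one_le_exp (D 2).re
    exact_mod_cast (by linarith : (0 : ℝ) ≤ Real.exp (D 2).re - (D 2).re)
  | succ n =>
    have e : deriv (fun s => Complex.exp (D s) - D s) =ᶠ[𝓝 2]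
        -((-deriv D) * fun s => Complex.exp (D s) - 1) := by
      filter_upwards [hD.eventually_analyticAt] with s hs
      rw [((hs.differentiableAt.hasDerivAt.cexp).fun_sub hs.differentiableAt.hasDerivAt).deriv]
      simp; ring
    rw [iteratedDeriv_succ', e.iteratedDeriv_eq, iteratedDeriv_neg]
    have h1 : CM (fun s => Complex.exp (D s) - 1) := by
      intro k
      cases k with
      | zero =>
        simp only [pow_zero, iteratedDeriv_zero, one_mul]
        rw [hre, ← Complex.ofReal_exp, ← Complex.ofReal_one, ← Complex.ofReal_sub]
        have := Real.add_one_le_exp (D 2).re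
        exact_mod_cast (by linarith : (0 : ℝ) ≤ Real.exp (D 2).re - 1)
      | succ k =>
        have := CM_exp hD h (k + 1)
        rw [iteratedDeriv_succ'] at this ⊢
        rwa [funext fun x ↦ deriv_sub_const (f := fun s => Complex.exp (D s)) (x := x) 1]
    have := leibniz_alt hD.deriv.neg (hE.fun_sub analyticAt_const) n (fun i _ => CM_neg_deriv h i) (fun i _ => h1 i)
    simpa [pow_succ] using this

lemma CM.add {f g : ℂ → ℂ} (hf : AnalyticAt ℂ f 2) (hg : AnalyticAt ℂ g 2) (h1 : CM f) (h2 : CM g) :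
    CM (f + g) := by
  intro n
  rw [iteratedDeriv_add hf.contDiffAt hg.contDiffAt, mul_add]
  exact add_nonneg (h1 n) (h2 n)

/-- Landau -/
theorem landau {F D₀ D₁ : ℂ → ℂ} (hF : DifferentiableOn ℂ F {s | 0 < s.re})
    (hD₀ : DifferentiableOn ℂ D₀ {s | 0 < s.re}) (a₁ : AnalyticAt ℂ D₁ 2) (c₀ : CM D₀) (c₁ : CM D₁)
    (hE : F =ᶠ[𝓝 2] fun s => Complex.exp (D₀ s + D₁ s)) {x : ℝ} (hx0 : 0 < x) (hx2 : x ≤ 2) :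
    0 ≤ F x - D₀ x := by
  have a₀ : AnalyticAt ℂ D₀ 2 := hD₀.analyticAt ((isOpen_halfplane 0).mem_nhds (by simp))
  have cs := CM.add a₀ a₁ c₀ c₁
  have as := a₀.add a₁
  have cH : CM (fun s => F s - D₀ s) := by
    have h1 := CM.add (as.cexp.sub as) a₁ (CM_exp_sub as cs) c₁
    intro n
    have e : (fun s => F s - D₀ s) =ᶠ[𝓝 2] ((fun s => Complex.exp ((D₀ + D₁) s) - (D₀ + D₁) s) + D₁) := by
      filter_upwards [hE] with s hs
      rw [hs]; simp; ring
    rw [e.iteratedDeriv_eq]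
    exact h1 n
  have key := DifferentiableOn.nonneg_of_iteratedDeriv_nonneg (f := fun z => F (-z) - D₀ (-z)) (c := -2) (r := 2)
    ?_ ?_ (z := -(x : ℂ)) ?_ ?_
  · simpa using key
  · have hm : Set.MapsTo (fun z : ℂ => -z) (Metric.ball (-2) 2) {s | 0 < s.re} := by
      intro z hz
      rw [Metric.mem_ball, dist_eq_norm] at hz
      have := (Complex.abs_re_le_norm _).trans_lt hz
      rw [abs_lt] at this
      simp at this ⊢
      linarith
    exact (hF.comp differentiable_neg.differentiableOn hm).sub (hD₀.comp differentiable_neg.differentiableOn hm)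
  · intro n
    rw [iteratedDeriv_comp_neg n (fun s => F s - D₀ s)]
    simpa using cH n
  · rw [neg_le_neg_iff]; exact_mod_cast hx2
  · rw [Metric.mem_ball, dist_eq_norm, show -(x : ℂ) - -2 = ((2 - x : ℝ) : ℂ) by push_cast; ring, Complex.norm_real,
      Real.norm_of_nonneg (by linarith)]
    linarith

end DSum
end Weber


namespace Weber
open Filter Topology Set MeasureTheory Asymptotics

section Mellin
variable {ι : Type*} (m : ι → ℕ)

/-- theta series -/
noncomputable def th (t : ℝ) : ℝ := ∑' i, Real.exp (-t * m i)

variable {m}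

lemma th_nonneg (t : ℝ) : 0 ≤ th m t := tsum_nonneg fun _ => (Real.exp_pos _).le

lemma th_tail (hm : ∀ i, m i ≠ 0) (hs : ∀ t : ℝ, 0 < t → Summable fun i => Real.exp (-t * m i))
    {t : ℝ} (ht : 1 ≤ t) : th m t ≤ th m 1 * Real.exp (1 - t) := by
  rw [th, th, ← tsum_mul_right]
  refine (hs t (by linarith)).tsum_le_tsum (fun i => ?_) ((hs 1 one_pos).mul_right _)
  rw [← Real.exp_add]
  apply Real.exp_le_exp.mpr
  have : (1 : ℝ) ≤ m i := by exact_mod_cast Nat.one_le_iff_ne_zero.mpr (hm i)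
  nlinarith

lemma th_bound (hm : ∀ i, m i ≠ 0) (hs : ∀ t : ℝ, 0 < t → Summable fun i => Real.exp (-t * m i))
    {κ C : ℝ} (hC : ∀ t : ℝ, 0 < t → t ≤ 1 → |th m t - κ / t| ≤ C) :
    ∃ A : ℝ, 0 ≤ A ∧ ∀ t : ℝ, 0 < t → th m t ≤ A * (Real.exp (-t) * t⁻¹ + Real.exp (-t)) := by
  have hC0 : 0 ≤ C := (abs_nonneg _).trans (hC 1 one_pos le_rfl)
  refine ⟨(|κ| + C + th m 1) * Real.exp 1, by have := th_nonneg (m := m) 1; positivity, fun t ht => ?_⟩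
  have h1 := th_nonneg (m := m) 1
  rcases le_total t 1 with h | h
  · have h2 := (abs_le.mp (hC t ht h)).2
    have h3 : κ / t ≤ |κ| * t⁻¹ := by rw [div_eq_mul_inv]; gcongr; exact le_abs_self _
    have h4 : 1 ≤ Real.exp 1 * Real.exp (-t) := by
      rw [← Real.exp_add]; apply Real.one_le_exp; linarith
    have h5 : 1 ≤ t⁻¹ := (one_le_inv₀ ht).mpr h
    calc th m t ≤ |κ| * t⁻¹ + C := by linarith
      _ ≤ (|κ| + C) * t⁻¹ := by nlinarith
      _ ≤ (|κ| + C + th m 1) * t⁻¹ * 1 := by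
          rw [mul_one]; exact mul_le_mul_of_nonneg_right (by linarith) (by positivity)
      _ ≤ (|κ| + C + th m 1) * t⁻¹ * (Real.exp 1 * Real.exp (-t)) := by gcongr
      _ = (|κ| + C + th m 1) * Real.exp 1 * (Real.exp (-t) * t⁻¹ + 0) := by ring
      _ ≤ _ := by gcongr; positivity
  · calc th m t ≤ th m 1 * Real.exp (1 - t) := th_tail hm hs h
      _ = th m 1 * Real.exp 1 * (0 + Real.exp (-t)) := by rw [sub_eq_add_neg, Real.exp_add]; ring
      _ ≤ _ := by
        gcongr
        · have := abs_nonneg κ; linarith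
        · positivity

lemma summable_rpow_of_th (hm : ∀ i, m i ≠ 0) (hs : ∀ t : ℝ, 0 < t → Summable fun i => Real.exp (-t * m i))
    {κ C : ℝ} (hC : ∀ t : ℝ, 0 < t → t ≤ 1 → |th m t - κ / t| ≤ C) {x : ℝ} (hx : 1 < x) :
    Summable fun i => (m i : ℝ) ^ (-x) := by
  obtain ⟨A, hA0, hA⟩ := th_bound hm hs hC
  have i1 := Real.GammaIntegral_convergent (show 0 < x - 1 by linarith)
  have i2 := Real.GammaIntegral_convergent (show 0 < x by linarith)
  have hG := Real.Gamma_pos_of_pos (show 0 < x by linarith)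
  have key : ∀ i, (m i : ℝ) ^ (-x) * Real.Gamma x = ∫ t in Ioi 0, t ^ (x - 1) * Real.exp (-(m i * t)) := by
    intro i
    rw [Real.integral_rpow_mul_exp_neg_mul_Ioi (by linarith) (by exact_mod_cast Nat.pos_of_ne_zero (hm i)),
      one_div, Real.inv_rpow (by positivity), Real.rpow_neg (by positivity)]
  have kint : ∀ i, IntegrableOn (fun t : ℝ => t ^ (x - 1) * Real.exp (-(m i * t))) (Ioi 0) := by
    intro i
    have : (∫ t in Ioi 0, t ^ (x - 1) * Real.exp (-(m i * t))) ≠ 0 := by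
      rw [← key]
      have : (0 : ℝ) < m i := by exact_mod_cast Nat.pos_of_ne_zero (hm i)
      positivity
    exact Integrable.of_integral_ne_zero this
  refine summable_of_sum_le (c := (∫ t in Ioi 0, A * (Real.exp (-t) * t ^ (x - 1 - 1) + Real.exp (-t) * t ^ (x - 1))) / Real.Gamma x)
    (fun i => by positivity) fun S => ?_
  rw [le_div_iff₀ hG, Finset.sum_mul, Finset.sum_congr rfl fun i _ => key i,
    ← integral_finsetSum _ fun i _ => kint i]
  refine setIntegral_mono_on (integrable_finsetSum _ fun i _ => kint i) ((i1.add i2).const_mul A) measurableSet_Ioi ?_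
  intro t ht
  have ht' : 0 < t := ht
  rw [← Finset.mul_sum]
  have h1 : ∑ i ∈ S, Real.exp (-(m i * t)) ≤ th m t := by
    refine le_trans (le_of_eq (Finset.sum_congr rfl fun i _ => ?_)) ((hs t ht).sum_le_tsum S fun i _ => (Real.exp_pos _).le)
    ring_nf
  calc t ^ (x - 1) * ∑ i ∈ S, Real.exp (-(m i * t)) ≤ t ^ (x - 1) * (A * (Real.exp (-t) * t⁻¹ + Real.exp (-t))) := by
        gcongr; exact h1.trans (hA t ht)
    _ = _ := by
      rw [Real.rpow_sub_one ht'.ne' (x - 1)]; ring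

lemma th_continuousOn (hs : ∀ t : ℝ, 0 < t → Summable fun i => Real.exp (-t * m i)) :
    ContinuousOn (th m) (Ioi 0) := by
  intro t ht
  have ht' : 0 < t := ht
  have : ContinuousOn (th m) (Ioi (t / 2)) := by
    refine continuousOn_tsum (fun i => by fun_prop) (hs (t / 2) (by linarith)) ?_
    intro i s hs
    have : t / 2 < s := hs
    rw [Real.norm_of_nonneg (Real.exp_pos _).le]
    apply Real.exp_le_exp.mpr
    have : (0 : ℝ) ≤ m i := by positivity
    nlinarith
  exact (this.continuousAt (Ioi_mem_nhds (by linarith))).continuousWithinAt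

theorem zeta_cont [Countable ι] (hm : ∀ i, m i ≠ 0)
    (hs : ∀ t : ℝ, 0 < t → Summable fun i => Real.exp (-t * m i))
    {κ C : ℝ} (hC : ∀ t : ℝ, 0 < t → t ≤ 1 → |th m t - κ / t| ≤ C) :
    ∃ E : ℂ → ℂ, DifferentiableOn ℂ E {s | 0 < s.re} ∧
      ∀ s : ℂ, 1 < s.re → ∑' i, (m i : ℂ) ^ (-s) = E s + κ / (s - 1) := by
  let f₁ : ℝ → ℂ := fun t => (th m t : ℂ)
  let f₂ : ℝ → ℂ := fun t => (κ : ℂ) * ((t : ℂ) ^ (-1 : ℂ) * (Real.exp (-t) : ℂ))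
  let f : ℝ → ℂ := fun t => f₁ t - f₂ t
  have f₂eq : ∀ t : ℝ, f₂ t = ((κ * (t⁻¹ * Real.exp (-t)) : ℝ) : ℂ) := by
    intro t; simp only [f₂, Complex.cpow_neg_one]; push_cast; rfl
  have c₁ : ContinuousOn f₁ (Ioi 0) := Complex.continuous_ofReal.comp_continuousOn (th_continuousOn hs)
  have c₂ : ContinuousOn f₂ (Ioi 0) := by
    rw [show f₂ = fun t => ((κ * (t⁻¹ * Real.exp (-t)) : ℝ) : ℂ) from funext f₂eq]
    refine Complex.continuous_ofReal.comp_continuousOn (continuousOn_const.mul (ContinuousOn.mul ?_ (by fun_prop)))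
    exact continuousOn_inv₀.mono fun t ht => (ne_of_gt ht)
  have t₁ : f₁ =O[atTop] fun t => Real.exp (-1 * t) := by
    refine IsBigO.of_bound (th m 1 * Real.exp 1) ?_
    filter_upwards [eventually_ge_atTop 1] with t ht
    rw [Complex.norm_real, Real.norm_of_nonneg (th_nonneg t), Real.norm_of_nonneg (Real.exp_pos _).le]
    refine (th_tail hm hs ht).trans (le_of_eq ?_)
    rw [mul_assoc, ← Real.exp_add]; ring_nf
  have t₂ : f₂ =O[atTop] fun t => Real.exp (-1 * t) := by
    refine IsBigO.of_bound |κ| ?_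
    filter_upwards [eventually_ge_atTop 1] with t ht
    have : t⁻¹ ≤ 1 := inv_le_one_of_one_le₀ ht
    rw [f₂eq, Complex.norm_real, norm_mul, norm_mul, Real.norm_eq_abs κ, Real.norm_of_nonneg (Real.exp_pos _).le,
      Real.norm_of_nonneg (by positivity), Real.norm_of_nonneg (Real.exp_pos _).le, neg_one_mul]
    gcongr
    exact mul_le_of_le_one_left (Real.exp_pos _).le this
  have b₁ : f =O[𝓝[>] 0] (fun t : ℝ => t ^ (-(0:ℝ))) := by
    refine IsBigO.of_bound (C + |κ|) ?_
    filter_upwards [Ioc_mem_nhdsGT (zero_lt_one' ℝ)] with t ht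
    simp only [f]
    rw [f₂eq, ← Complex.ofReal_sub, Complex.norm_real]
    simp only [neg_zero, Real.rpow_zero, norm_one, mul_one]
    have e : th m t - κ * (t⁻¹ * Real.exp (-t)) = (th m t - κ / t) + κ * (t⁻¹ * (1 - Real.exp (-t))) := by
      rw [div_eq_mul_inv]; ring
    rw [e]
    refine (norm_add_le _ _).trans (add_le_add (hC t ht.1 ht.2) ?_)
    have h1 : t⁻¹ * (1 - Real.exp (-t)) ≤ 1 := by
      rw [inv_mul_le_iff₀ ht.1]
      have := Real.add_one_le_exp (-t); linarith
    have h0 : 0 ≤ t⁻¹ * (1 - Real.exp (-t)) := by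
      have : Real.exp (-t) ≤ 1 := Real.exp_le_one_iff.mpr (by linarith [ht.1])
      have := ht.1
      exact mul_nonneg (by positivity) (by linarith)
    rw [norm_mul, Real.norm_eq_abs κ, Real.norm_of_nonneg h0]
    exact mul_le_of_le_one_right (abs_nonneg _) h1
  have hli : LocallyIntegrableOn f (Ioi 0) := (c₁.sub c₂).locallyIntegrableOn measurableSet_Ioi
  have hft : f =O[atTop] fun t => Real.exp (-1 * t) := t₁.sub t₂
  have hfconv : ∀ s : ℂ, 0 < s.re → MellinConvergent f s := fun s hs =>
    mellinConvergent_of_isBigO_rpow_exp one_pos hli hft b₁ hs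
  have hfd : DifferentiableOn ℂ (mellin f) {s | 0 < s.re} := fun s hs =>
    (mellin_differentiableAt_of_isBigO_rpow_exp one_pos hli hft b₁ hs).differentiableWithinAt
  refine ⟨fun s => (Complex.Gamma s)⁻¹ * mellin f s,
    Complex.differentiable_one_div_Gamma.differentiableOn.mul hfd, fun s hs1 => ?_⟩
  have hs0 : 0 < s.re := by linarith
  have hΓ : Complex.Gamma s ≠ 0 := Complex.Gamma_ne_zero_of_re_pos hs0
  have H := hasSum_mellin (a := fun _ : ι => (1 : ℂ)) (p := fun i => (m i : ℝ)) (F := f₁) (s := s)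
    (fun i => Or.inr (by exact_mod_cast Nat.pos_of_ne_zero (hm i))) hs0 ?_ ?_
  · have H2 : mellin f₂ s = κ * Complex.Gamma (s - 1) ∧ MellinConvergent f₂ s := by
      have g1 : MellinConvergent (fun t : ℝ => (Real.exp (-t) : ℂ)) (s + (-1)) := by
        have := Complex.GammaIntegral_convergent (s := s + (-1)) (by simp; linarith)
        rw [MellinConvergent]
        refine this.congr_fun (fun t _ => ?_) measurableSet_Ioi
        simp [mul_comm]
      have g2 := MellinConvergent.cpow_smul (f := fun t : ℝ => (Real.exp (-t) : ℂ)) (s := s) (a := -1)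
      have g3 := g2.mpr g1
      constructor
      · have := (hasMellin_const_smul g3 (κ : ℂ)).2
        rw [mellin_cpow_smul] at this
        simp only [smul_eq_mul] at this
        rw [show f₂ = _ from rfl, this, ← sub_eq_add_neg, Complex.Gamma_eq_integral (by simp; linarith), Complex.GammaIntegral_eq_mellin]
      · exact (hasMellin_const_smul g3 (κ : ℂ)).1
    have H3 : MellinConvergent f₁ s := by
      have := (hasMellin_sub (hfconv s hs0) ((hasMellin_const_smul H2.2 (-1 : ℂ)).1)).1
      simpa [f] using this
    have H4 := (hasMellin_sub H3 H2.2).2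
    have H5 : mellin f₁ s = Complex.Gamma s * ∑' i, (m i : ℂ) ^ (-s) := by
      rw [← H.tsum_eq, ← tsum_mul_left]
      congr 1; ext i
      rw [Complex.cpow_neg]; simp [div_eq_mul_inv]
    change mellin f s = _ at H4
    have hs1' : s - 1 ≠ 0 := by
      intro h; rw [sub_eq_zero] at h; rw [h] at hs1; simp at hs1
    have H6 : Complex.Gamma s = (s - 1) * Complex.Gamma (s - 1) := by
      rw [← Complex.Gamma_add_one _ hs1']; simp
    simp only []
    rw [H4, H5, H2.1]
    field_simp
    rw [H6]; ring
  · intro t ht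
    have := (hs t ht).hasSum
    rw [← Complex.hasSum_ofReal] at this
    refine this.congr_fun ?_ |> fun h => h
    intro i; simp; ring_nf
  · refine (summable_rpow_of_th hm hs hC hs1).congr fun i => ?_
    rw [Real.rpow_neg (by positivity)]; simp
end Mellin
end Weber


namespace Weber
set_option linter.unusedSectionVars false
open Filter Topology Set

section Chars
variable {G : Type*} [CommGroup G] [Finite G]

noncomputable instance charFintype : Fintype (G →* ℂˣ) := Fintype.ofFinite _

lemma char_sum_right [Fintype G] (χ : G →* ℂˣ) (hχ : χ ≠ 1) : ∑ g, (χ g : ℂ) = 0 := by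
  obtain ⟨a, ha⟩ : ∃ a, χ a ≠ 1 := by
    by_contra! h; exact hχ (MonoidHom.ext fun a => by simpa using h a)
  have : (χ a : ℂ) * ∑ g, (χ g : ℂ) = ∑ g, (χ g : ℂ) := by
    rw [Finset.mul_sum]
    exact Fintype.sum_equiv (Equiv.mulLeft a) _ _ fun g => by simp
  have h1 : ((χ a : ℂ) - 1) * ∑ g, (χ g : ℂ) = 0 := by rw [sub_mul, this]; ring
  rcases mul_eq_zero.mp h1 with h | h
  · exact absurd (Units.ext (sub_eq_zero.mp h)) ha
  · exact h

lemma char_sum_left (g : G) (hg : g ≠ 1) : ∑ χ : G →* ℂˣ, (χ g : ℂ) = 0 := by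
  obtain ⟨ψ, hψ⟩ := CommGroup.exists_apply_ne_one_of_hasEnoughRootsOfUnity G ℂ hg
  have : (ψ g : ℂ) * ∑ χ : G →* ℂˣ, (χ g : ℂ) = ∑ χ : G →* ℂˣ, (χ g : ℂ) := by
    rw [Finset.mul_sum]
    exact Fintype.sum_equiv (Equiv.mulLeft ψ) _ _ fun χ => by simp
  have h1 : ((ψ g : ℂ) - 1) * ∑ χ : G →* ℂˣ, (χ g : ℂ) = 0 := by rw [sub_mul, this]; ring
  rcases mul_eq_zero.mp h1 with h | h
  · exact absurd (Units.ext (sub_eq_zero.mp h)) hψ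
  · exact h

lemma char_sum_one : ∑ χ : G →* ℂˣ, (χ (1 : G) : ℂ) = Nat.card G := by
  simp only [map_one, Units.val_one, Finset.sum_const, nsmul_eq_mul, mul_one, Finset.card_univ]
  rw [← CommGroup.card_monoidHom_of_hasEnoughRootsOfUnity G ℂ, Nat.card_eq_fintype_card]

lemma char_norm (χ : G →* ℂˣ) (g : G) : ‖(χ g : ℂ)‖ = 1 := by
  have : (χ g : ℂ) ^ Nat.card G = 1 := by
    rw [← Units.val_pow_eq_pow_val, ← map_pow, pow_card_eq_one', map_one, Units.val_one]
  exact Complex.norm_eq_one_of_pow_eq_one this Nat.card_pos.ne'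
end Chars

structure HData (R G : Type*) [CommMonoidWithZero R] [CommGroup G] where
  N : R →*₀ ℕ
  cl : R →*₀ WithZero G
  hN : ∀ a, cl a ≠ 0 → N a ≠ 0
  hth : ∀ (g : G) (t : ℝ), 0 < t → Summable fun a : {a // cl a = (g : WithZero G)} => Real.exp (-t * N a.1)
  κ : ℝ
  hκ : 0 < κ
  hC : ∀ g : G, ∃ C : ℝ, ∀ t : ℝ, 0 < t → t ≤ 1 →
    |th (fun a : {a // cl a = (g : WithZero G)} => N a.1) t - κ / t| ≤ C
  hdeg : ∀ x : ℝ, 3 / 4 < x →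
    Summable fun p : {p : R // Prime p ∧ cl p ≠ 0 ∧ ¬ (N p).Prime} => (N p.1 : ℝ) ^ (-x)

namespace HData
variable {R G : Type*} [CommMonoidWithZero R] [UniqueFactorizationMonoid R] [Subsingleton Rˣ]
  [Nontrivial R] [Countable R] [CommGroup G] [Fintype G] (D : HData R G)

abbrev Cls (g : G) := {a : R // D.cl a = (g : WithZero G)}

lemma N_ne (g : G) (a : D.Cls g) : D.N a.1 ≠ 0 := D.hN _ (by rw [a.2]; exact WithZero.coe_ne_zero)

noncomputable def zeta (g : G) (s : ℂ) : ℂ := ∑' a : D.Cls g, (D.N a.1 : ℂ) ^ (-s)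

lemma zsum (g : G) {x : ℝ} (hx : 1 < x) : Summable fun a : D.Cls g => (D.N a.1 : ℝ) ^ (-x) := by
  obtain ⟨C, hC⟩ := D.hC g
  exact summable_rpow_of_th (m := fun a : D.Cls g => D.N a.1) (D.N_ne g) (D.hth g) hC hx

lemma zeta_cont (g : G) : ∃ E : ℂ → ℂ, DifferentiableOn ℂ E {s | 0 < s.re} ∧
      ∀ s : ℂ, 1 < s.re → D.zeta g s = E s + D.κ / (s - 1) := by
  obtain ⟨C, hC⟩ := D.hC g
  exact Weber.zeta_cont (m := fun a : D.Cls g => D.N a.1) (D.N_ne g) (D.hth g) hC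

noncomputable def L (χ : G →* ℂˣ) (s : ℂ) : ℂ := ∑ g, (χ g : ℂ) * D.zeta g s

/-- the summand as a hom -/
noncomputable def f (χ : G →* ℂˣ) {s : ℂ} (hs : s ≠ 0) : R →*₀ ℂ where
  toFun a := WithZero.lift' ((Units.coeHom ℂ).comp χ) (D.cl a) * riemannZetaSummandHom hs (D.N a)
  map_zero' := by simp
  map_one' := by simp
  map_mul' a b := by simp only [map_mul]; ring

lemma f_cls (χ : G →* ℂˣ) {s : ℂ} (hs : s ≠ 0) {g : G} {a : R} (h : D.cl a = (g : WithZero G)) :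
    D.f χ hs a = χ g * (D.N a : ℂ) ^ (-s) := by
  simp [f, h, riemannZetaSummandHom]

lemma f_zero (χ : G →* ℂˣ) {s : ℂ} (hs : s ≠ 0) {a : R} (h : D.cl a = 0) :
    D.f χ hs a = 0 := by
  simp [f, h]

/-- forget -/
def toR (i : Σ g : G, D.Cls g) : R := i.2.1

lemma toR_inj : Function.Injective D.toR := by
  rintro ⟨g, a, ha⟩ ⟨g', a', ha'⟩ h
  simp only [toR] at h
  subst h
  have : g = g' := by rw [ha] at ha'; exact_mod_cast ha'
  subst this; rfl

lemma mem_range_toR {a : R} (h : D.cl a ≠ 0) : a ∈ Set.range D.toR := by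
  obtain ⟨g, hg⟩ := WithZero.ne_zero_iff_exists.mp h
  exact ⟨⟨g, a, hg.symm⟩, rfl⟩

lemma zsum_all {x : ℝ} (hx : 1 < x) : Summable fun i : Σ g : G, D.Cls g => (D.N (D.toR i) : ℝ) ^ (-x) := by
  rw [summable_sigma_of_nonneg (fun i => by positivity)]
  exact ⟨fun g => D.zsum g hx, (hasSum_fintype _).summable⟩

lemma norm_f (χ : G →* ℂˣ) {s : ℂ} (hs : s ≠ 0) (i : Σ g : G, D.Cls g) :
    ‖D.f χ hs (D.toR i)‖ = (D.N (D.toR i) : ℝ) ^ (-s.re) := by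
  obtain ⟨g, a⟩ := i
  rw [toR, D.f_cls χ hs a.2, norm_mul, char_norm, one_mul,
    Complex.norm_natCast_cpow_of_pos (Nat.pos_of_ne_zero (D.N_ne g a)), Complex.neg_re]

lemma support_f (χ : G →* ℂˣ) {s : ℂ} (hs : s ≠ 0) : Function.support (D.f χ hs) ⊆ Set.range D.toR := by
  intro a ha
  exact D.mem_range_toR fun h => ha (D.f_zero χ hs h)

lemma summable_f (χ : G →* ℂˣ) {s : ℂ} (hs : s ≠ 0) (h1 : 1 < s.re) : Summable fun a => ‖D.f χ hs a‖ := by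
  rw [← D.toR_inj.summable_iff]
  · refine (D.zsum_all h1).congr fun i => (D.norm_f χ hs i).symm
  · intro a ha
    rw [norm_eq_zero]
    by_contra h
    exact ha (D.support_f χ hs h)

lemma tsum_f (χ : G →* ℂˣ) {s : ℂ} (hs : s ≠ 0) (h1 : 1 < s.re) : ∑' a, D.f χ hs a = D.L χ s := by
  rw [← D.toR_inj.tsum_eq (D.support_f χ hs), Summable.tsum_sigma, tsum_fintype]
  · refine Finset.sum_congr rfl fun g _ => ?_
    rw [zeta, ← tsum_mul_left]
    refine tsum_congr fun a => ?_
    rw [toR, D.f_cls χ hs a.2]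
  · exact ((D.summable_f χ hs h1).comp_injective D.toR_inj).of_norm

abbrev P := {p : R // Prime p ∧ D.cl p ≠ 0}

noncomputable def gp (p : D.P) : G := WithZero.unzero p.2.2

lemma gp_spec (p : D.P) : D.cl p.1 = (D.gp p : WithZero G) := (WithZero.coe_unzero _).symm

lemma two_le_N (p : D.P) : 2 ≤ D.N p.1 := by
  have h := norm_lt_one_of_summable (D.summable_f 1 (s := 2) two_ne_zero (by norm_num)) ⟨p.1, p.2.1⟩
  have := D.norm_f 1 (s := 2) two_ne_zero ⟨D.gp p, p.1, D.gp_spec p⟩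
  simp only [toR] at this
  simp only [this] at h
  by_contra h2
  have h3 := D.hN _ p.2.2
  have h4 : D.N p.1 = 1 := by omega
  rw [h4] at h
  simp at h

lemma Npow_ne (j : D.P × ℕ) : D.N j.1.1 ^ (j.2 + 1) ≠ 0 := pow_ne_zero _ (D.hN _ j.1.2.2)

/-- prime powers -/
noncomputable def pp (j : D.P × ℕ) : Σ g : G, D.Cls g :=
  ⟨D.gp j.1 ^ (j.2 + 1), j.1.1 ^ (j.2 + 1), by rw [map_pow, gp_spec, WithZero.coe_pow]⟩

lemma pp_inj : Function.Injective D.pp := by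
  rintro ⟨p, k⟩ ⟨q, j⟩ h
  have h1 : p.1 ^ (k + 1) = q.1 ^ (j + 1) := congrArg D.toR h
  have h2 : p.1 = q.1 := prime_eq_of_dvd p.2.1 q.2.1
    (p.2.1.dvd_of_dvd_pow (h1 ▸ dvd_pow_self p.1 (Nat.succ_ne_zero k)))
  have h3 : p = q := Subtype.ext h2
  subst h3
  have h4 := congrArg D.N h1
  rw [map_pow, map_pow] at h4
  have := Nat.pow_right_injective (D.two_le_N p) h4
  simp only [Prod.mk.injEq, true_and]; omega

lemma psum {x : ℝ} (hx : 1 < x) : Summable fun j : D.P × ℕ => ((D.N j.1.1 ^ (j.2 + 1) : ℕ) : ℝ) ^ (-x) := by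
  refine ((D.zsum_all hx).comp_injective D.pp_inj).congr fun j => ?_
  simp [pp, toR]

/-- exponents norm -/
def mm (j : D.P × ℕ) : ℕ := D.N j.1.1 ^ (j.2 + 1)

/-- logarithm weights associated to a function on G -/
noncomputable def wt (c : G → ℂ) (j : D.P × ℕ) : ℂ := c (D.gp j.1 ^ (j.2 + 1)) / (j.2 + 1)

lemma wt_summable (c : G → ℂ) {x : ℝ} (hx : 1 < x) : Summable fun j => ‖D.wt c j‖ * (D.mm j : ℝ) ^ (-x) := by
  refine Summable.of_nonneg_of_le (fun j => by positivity) (fun j => ?_) ((D.psum hx).mul_left (∑ g, ‖c g‖))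
  refine mul_le_mul_of_nonneg_right ?_ (by positivity)
  rw [wt, norm_div]
  have h1 : 1 ≤ ‖(j.2 + 1 : ℂ)‖ := by
    have : (j.2 + 1 : ℂ) = ((j.2 + 1 : ℕ) : ℂ) := by push_cast; rfl
    rw [this, Complex.norm_natCast]; norm_num
  refine (div_le_self (norm_nonneg _) h1).trans ?_
  exact Finset.single_le_sum (f := fun g => ‖c g‖) (fun _ _ => norm_nonneg _) (Finset.mem_univ _)

noncomputable def ell (c : G → ℂ) (s : ℂ) : ℂ := DS (D.wt c) D.mm s

lemma ell_analytic (c : G → ℂ) {s : ℂ} (hs : 1 < s.re) : AnalyticAt ℂ (D.ell c) s :=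
  DS_analyticAt _ _ D.Npow_ne 1 (fun _ hx => D.wt_summable c hx) hs

lemma ell_summable (c : G → ℂ) {s : ℂ} (hs : 1 < s.re) :
    Summable fun j => D.wt c j * (D.mm j : ℂ) ^ (-s) := by
  refine Summable.of_norm ((D.wt_summable c hs).congr fun j => ?_)
  rw [norm_mul, Complex.norm_natCast_cpow_of_pos (n := D.mm j) (Nat.pos_of_ne_zero (D.Npow_ne j)), Complex.neg_re]

lemma ell_sum {X : Type*} (T : Finset X) (c : X → G → ℂ) {s : ℂ} (hs : 1 < s.re) :
    ∑ x ∈ T, D.ell (c x) s = D.ell (fun g => ∑ x ∈ T, c x g) s := by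
  simp only [ell, DS]
  rw [← Summable.tsum_finsetSum fun x _ => D.ell_summable (c x) hs]
  refine tsum_congr fun j => ?_
  simp only [wt, Finset.sum_div, Finset.sum_mul]

lemma ell_mul (a : ℂ) (c : G → ℂ) (s : ℂ) : D.ell (fun g => a * c g) s = a * D.ell c s := by
  simp only [ell, DS, wt, ← tsum_mul_left]
  refine tsum_congr fun j => by ring

theorem exp_ell (χ : G →* ℂˣ) {s : ℂ} (h1 : 1 < s.re) :
    Complex.exp (D.ell (fun g => (χ g : ℂ)) s) = D.L χ s := by
  have hs : s ≠ 0 := by rintro rfl; simp at h1; linarith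
  rw [← D.tsum_f χ hs h1, ← euler_exp (D.summable_f χ hs h1)]
  congr 1
  let e : D.P → {p : R // Prime p} := fun p => ⟨p.1, p.2.1⟩
  have he : Function.Injective e := fun p q h => Subtype.ext (congrArg (fun z => z.1) h)
  rw [← he.tsum_eq, ell, DS, (D.ell_summable _ h1).tsum_prod]
  · refine tsum_congr fun p => ?_
    have hlt := norm_lt_one_of_summable (D.summable_f χ hs h1) (e p)
    have H := (hasSum_nat_add_iff' 1).mpr (Complex.hasSum_taylorSeries_neg_log hlt)
    simp only [Finset.range_one, Finset.sum_singleton, pow_zero, Nat.cast_zero, div_zero, sub_zero] at H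
    rw [← H.tsum_eq]
    refine tsum_congr fun k => ?_
    simp only [e]
    rw [D.f_cls χ hs (D.gp_spec p), wt, mm, mul_pow, map_pow, Units.val_pow_eq_pow_val,
      Nat.cast_pow, ← Complex.natCast_cpow_natCast_mul, Complex.cpow_nat_mul]
    push_cast; ring
  · intro p hp
    by_contra h
    apply hp
    have : D.cl p.1 = 0 := by
      by_contra h0; exact h ⟨⟨p.1, p.2, h0⟩, rfl⟩
    simp [D.f_zero χ hs this]
end HData
end Weber


namespace Weber
set_option linter.unusedSectionVars false
open Filter Topology Set

namespace HData
open ComplexOrder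
variable {R G : Type*} [CommMonoidWithZero R] [UniqueFactorizationMonoid R] [Subsingleton Rˣ]
  [Nontrivial R] [Countable R] [CommGroup G] [Fintype G] (D : HData R G)

open Classical in
/-- order of pole -/
noncomputable def ee (χ : G →* ℂˣ) : ℕ := if χ = 1 then 1 else 0

lemma exists_Lam (χ : G →* ℂˣ) : ∃ Λ : ℂ → ℂ, DifferentiableOn ℂ Λ {s | 0 < s.re} ∧
    (∀ s : ℂ, 1 < s.re → Λ s = (s - 1) ^ ee χ * D.L χ s) ∧ (χ = 1 → Λ 1 ≠ 0) := by
  choose E hE hE2 using D.zeta_cont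
  have hd : DifferentiableOn ℂ (fun s => ∑ g, (χ g : ℂ) * E g s) {s | 0 < s.re} :=
    DifferentiableOn.fun_sum fun g _ => (differentiableOn_const _).mul (hE g)
  have hL : ∀ s : ℂ, 1 < s.re → D.L χ s = ∑ g, (χ g : ℂ) * E g s + (∑ g, (χ g : ℂ)) * (D.κ / (s - 1)) := by
    intro s hs
    rw [L, Finset.sum_mul, ← Finset.sum_add_distrib]
    exact Finset.sum_congr rfl fun g _ => by rw [hE2 g s hs]; ring
  by_cases h : χ = 1
  · refine ⟨fun s => (s - 1) * (∑ g, (χ g : ℂ) * E g s) + (∑ g, (χ g : ℂ)) * D.κ,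
      ((differentiableOn_id.sub (differentiableOn_const _)).mul hd).add (differentiableOn_const _), ?_, ?_⟩
    · intro s hs
      have hs1 : s - 1 ≠ 0 := by
        intro h; rw [sub_eq_zero] at h; rw [h] at hs; simp at hs
      rw [hL s hs, ee, if_pos h]
      field_simp
    · intro _
      have := D.hκ.ne'
      subst h
      simp [this]
  · refine ⟨fun s => ∑ g, (χ g : ℂ) * E g s, hd, ?_, fun h' => absurd h' h⟩
    intro s hs
    rw [hL s hs, ee, if_neg h, char_sum_right χ h]; simp

noncomputable def Lam (χ : G →* ℂˣ) : ℂ → ℂ := (D.exists_Lam χ).choose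
lemma Lam_diff (χ : G →* ℂˣ) : DifferentiableOn ℂ (D.Lam χ) {s | 0 < s.re} := (D.exists_Lam χ).choose_spec.1
lemma Lam_eq (χ : G →* ℂˣ) {s : ℂ} (hs : 1 < s.re) : D.Lam χ s = (s - 1) ^ ee χ * D.L χ s :=
  (D.exists_Lam χ).choose_spec.2.1 s hs
lemma Lam_one : D.Lam 1 1 ≠ 0 := (D.exists_Lam 1).choose_spec.2.2 rfl

lemma Lam_analytic (χ : G →* ℂˣ) : AnalyticAt ℂ (D.Lam χ) 1 :=
  (D.Lam_diff χ).analyticAt ((isOpen_halfplane 0).mem_nhds (by simp))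

/-- filter: real numbers tending to 1 from the right -/
lemma tendsto_real : Tendsto (fun x : ℝ => (x : ℂ)) (𝓝[>] 1) (𝓝 1) := by
  have : Tendsto (fun x : ℝ => (x : ℂ)) (𝓝 1) (𝓝 ((1 : ℝ) : ℂ)) := Complex.continuous_ofReal.tendsto 1
  simpa using this.mono_left nhdsWithin_le_nhds

lemma not_summable_inv : ¬ Summable fun p : D.P => (D.N p.1 : ℝ)⁻¹ := by
  intro H
  have hgeo : Summable fun k : ℕ => ((1 : ℝ) / 2) ^ k := summable_geometric_two
  have H2 : Summable fun j : D.P × ℕ => ((D.mm j : ℝ))⁻¹ := by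
    refine Summable.of_nonneg_of_le (fun j => by positivity) (fun j => ?_)
      (H.mul_of_nonneg hgeo (fun p => by positivity) (fun k => by positivity))
    have h2 : (2 : ℝ) ≤ D.N j.1.1 := by exact_mod_cast D.two_le_N j.1
    rw [mm, Nat.cast_pow, pow_succ, mul_inv, mul_comm, one_div, inv_pow]
    gcongr
  have hB : ∀ x : ℝ, 1 < x → ‖D.L 1 x‖ ≤ Real.exp (∑' j, ((D.mm j : ℝ))⁻¹) := by
    intro x hx
    rw [← D.exp_ell 1 (by simpa using hx), Complex.norm_exp]
    apply Real.exp_le_exp.mpr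
    refine (Complex.re_le_norm _).trans ?_
    rw [ell, DS]
    refine tsum_of_norm_bounded H2.hasSum fun j => ?_
    have hm : 1 ≤ D.mm j := Nat.one_le_iff_ne_zero.mpr (D.Npow_ne j)
    have hm' : (1 : ℝ) ≤ D.mm j := by exact_mod_cast hm
    rw [norm_mul, Complex.norm_natCast_cpow_of_pos hm, ← one_mul ((D.mm j : ℝ))⁻¹]
    refine mul_le_mul ?_ ?_ (by positivity) zero_le_one
    · rw [wt]
      have h1 : 1 ≤ ‖(j.2 + 1 : ℂ)‖ := by
        have : (j.2 + 1 : ℂ) = ((j.2 + 1 : ℕ) : ℂ) := by push_cast; rfl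
        rw [this, Complex.norm_natCast]; norm_num
      rw [norm_div, char_norm]
      exact div_le_self zero_le_one h1
    · rw [← Real.rpow_neg_one]
      exact Real.rpow_le_rpow_of_exponent_le hm' (by simp; exact hx.le)
  have t1 : Tendsto (fun x : ℝ => D.Lam 1 x) (𝓝[>] 1) (𝓝 (D.Lam 1 1)) :=
    (D.Lam_analytic 1).continuousAt.tendsto.comp tendsto_real
  have t2 : Tendsto (fun x : ℝ => D.Lam 1 x) (𝓝[>] 1) (𝓝 0) := by
    have t3 : Tendsto (fun x : ℝ => ‖x - 1‖ * Real.exp (∑' j, ((D.mm j : ℝ))⁻¹)) (𝓝[>] 1) (𝓝 0) := by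
      have : Continuous (fun x : ℝ => ‖x - 1‖ * Real.exp (∑' j, ((D.mm j : ℝ))⁻¹)) := by fun_prop
      have := (this.tendsto 1).mono_left (nhdsWithin_le_nhds (s := Ioi 1))
      simpa using this
    refine squeeze_zero_norm' ?_ t3
    filter_upwards [self_mem_nhdsWithin] with x hx
    rw [D.Lam_eq 1 (by simpa using hx), ee, if_pos rfl, pow_one, norm_mul]
    refine mul_le_mul (le_of_eq ?_) (hB x hx) (norm_nonneg _) (norm_nonneg _)
    rw [← Complex.norm_real]; simp
  exact D.Lam_one (tendsto_nhds_unique t1 t2)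

lemma csum (g : G) : (∑ χ : G →* ℂˣ, (χ g : ℂ)) = open Classical in if g = 1 then (Fintype.card G : ℂ) else 0 := by
  split_ifs with h
  · subst h; rw [char_sum_one, Nat.card_eq_fintype_card]
  · exact char_sum_left g h

theorem nonvanish (χ₀ : G →* ℂˣ) : D.Lam χ₀ 1 ≠ 0 := by
  classical
  by_cases hχ : χ₀ = 1
  · rw [hχ]; exact D.Lam_one
  intro h0
  set hc := Fintype.card G with hcdef
  have hc0 : 0 < hc := Fintype.card_pos
  let F : ℂ → ℂ := fun s => D.Lam 1 s * dslope (D.Lam χ₀) 1 s *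
    ∏ χ ∈ (Finset.univ.erase 1).erase χ₀, D.Lam χ s
  have hF : DifferentiableOn ℂ F {s | 0 < s.re} := by
    refine ((D.Lam_diff 1).mul ((Complex.differentiableOn_dslope ?_).mpr (D.Lam_diff χ₀))).mul ?_
    · exact (isOpen_halfplane 0).mem_nhds (by simp)
    · exact DifferentiableOn.fun_finsetProd fun χ _ => D.Lam_diff χ
  let c : G → ℂ := fun g => ∑ χ : G →* ℂˣ, (χ g : ℂ)
  have hF2 : ∀ s : ℂ, 1 < s.re → F s = Complex.exp (D.ell c s) := by
    intro s hs
    have hs1 : s ≠ 1 := by rintro rfl; simp at hs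
    have hs1' : s - 1 ≠ 0 := sub_ne_zero.mpr hs1
    have e1 : D.ell c s = ∑ χ : G →* ℂˣ, D.ell (fun g => (χ g : ℂ)) s :=
      (D.ell_sum Finset.univ (fun (χ : G →* ℂˣ) g => (χ g : ℂ)) hs).symm
    rw [e1, Complex.exp_sum, ← Finset.mul_prod_erase _ _ (Finset.mem_univ (1 : G →* ℂˣ)),
      ← Finset.mul_prod_erase _ _ (Finset.mem_erase.mpr ⟨hχ, Finset.mem_univ χ₀⟩)]
    simp only [F]
    rw [dslope_of_ne _ hs1, slope_def_field, h0, D.Lam_eq 1 hs, D.Lam_eq χ₀ hs, ee, if_pos rfl, ee, if_neg hχ,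
      D.exp_ell 1 hs, D.exp_ell χ₀ hs]
    have : ∏ χ ∈ (Finset.univ.erase 1).erase χ₀, D.Lam χ s =
        ∏ χ ∈ (Finset.univ.erase 1).erase χ₀, Complex.exp (D.ell (fun g => (χ g : ℂ)) s) := by
      refine Finset.prod_congr rfl fun χ hχ' => ?_
      have : χ ≠ 1 := (Finset.mem_erase.mp (Finset.mem_erase.mp hχ').2).1
      rw [D.Lam_eq χ hs, D.exp_ell χ hs, ee, if_neg this]; simp
    rw [this]
    field_simp
    simp
  have hW : ∀ j, 0 ≤ D.wt c j := by
    intro j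
    simp only [wt, c, csum]
    split_ifs
    · rw [show ((Fintype.card G : ℂ) / (j.2 + 1)) = ((Fintype.card G / (j.2 + 1) : ℝ) : ℂ) by push_cast; rfl]
      exact_mod_cast (by positivity : (0 : ℝ) ≤ Fintype.card G / (j.2 + 1))
    · simp
  have hW1 : ∀ j : D.P × ℕ, j.2 = hc - 1 → D.wt c j = 1 := by
    intro j hj
    have : j.2 + 1 = hc := by omega
    have h2 : (j.2 + 1 : ℂ) = hc := by rw [← this]; push_cast; rfl
    simp only [wt, c, csum]
    rw [this, h2, if_pos (pow_card_eq_one)]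
    exact div_self (by exact_mod_cast hc0.ne')
  apply D.not_summable_inv
  have hxpos : (0 : ℝ) < 1 / hc := by positivity
  have hxle : (1 : ℝ) / hc ≤ 2 := by
    rw [div_le_iff₀ (by positivity)]
    have : (1 : ℝ) ≤ hc := by exact_mod_cast hc0
    linarith
  refine summable_of_sum_le (c := (F ((1 / hc : ℝ) : ℂ)).re) (fun p => by positivity) fun S => ?_
  let T : Finset (D.P × ℕ) := S.map ⟨fun p => (p, hc - 1), fun p q h => (Prod.mk.inj h).1⟩
  have hT : ∀ j ∈ T, j.2 = hc - 1 := by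
    intro j hj
    obtain ⟨p, _, rfl⟩ := Finset.mem_map.mp hj
    rfl
  let W₀ : D.P × ℕ → ℂ := fun j => if j ∈ T then 1 else 0
  let W₁ : D.P × ℕ → ℂ := fun j => if j ∈ T then 0 else D.wt c j
  have s₀ : ∀ x : ℝ, Summable fun j => ‖W₀ j‖ * (D.mm j : ℝ) ^ (-x) := by
    intro x
    refine summable_of_ne_finset_zero (s := T) fun j hj => ?_
    simp [W₀, hj]
  have s₁ : ∀ x : ℝ, 1 < x → Summable fun j => ‖W₁ j‖ * (D.mm j : ℝ) ^ (-x) := by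
    intro x hx
    refine Summable.of_nonneg_of_le (fun j => by positivity) (fun j => ?_) (D.wt_summable c hx)
    refine mul_le_mul_of_nonneg_right ?_ (by positivity)
    simp only [W₁]; split_ifs
    · simp
    · exact le_rfl
  have hsum : ∀ s : ℂ, 1 < s.re → D.ell c s = DS W₀ D.mm s + DS W₁ D.mm s := by
    intro s hs
    have cv : ∀ w : D.P × ℕ → ℂ, (Summable fun j => ‖w j‖ * (D.mm j : ℝ) ^ (-s.re)) →
        Summable fun j => w j * (D.mm j : ℂ) ^ (-s) := by
      intro w hw
      refine Summable.of_norm (hw.congr fun j => ?_)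
      rw [norm_mul, Complex.norm_natCast_cpow_of_pos (n := D.mm j) (Nat.pos_of_ne_zero (D.Npow_ne j)), Complex.neg_re]
    rw [DS, DS, ← (cv _ (s₀ _)).tsum_add (cv _ (s₁ _ hs)), ell, DS]
    refine tsum_congr fun j => ?_
    simp only [W₀, W₁]
    split_ifs with hj
    · rw [hW1 j (hT j hj)]; ring
    · ring
  have two : (1 : ℝ) < (2 : ℂ).re := by norm_num
  have key := landau (F := F) (D₀ := DS W₀ D.mm) (D₁ := DS W₁ D.mm) hF
    (fun s hs => (DS_analyticAt W₀ D.mm D.Npow_ne 0 (fun x _ => s₀ x) hs).differentiableAt.differentiableWithinAt)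
    (DS_analyticAt W₁ D.mm D.Npow_ne 1 s₁ two)
    (DS_CM W₀ D.mm D.Npow_ne (fun j => by simp only [W₀]; split_ifs <;> simp) (fun x _ => s₀ x))
    (DS_CM W₁ D.mm D.Npow_ne (fun j => by simp only [W₁]; split_ifs; exacts [le_rfl, hW j]) s₁)
    (by
      filter_upwards [(isOpen_halfplane 1).mem_nhds two] with s hs
      rw [hF2 s hs, hsum s hs]) hxpos hxle
  have e0 : DS W₀ D.mm ((1 / hc : ℝ) : ℂ) = ((∑ p ∈ S, (D.N p.1 : ℝ)⁻¹ : ℝ) : ℂ) := by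
    rw [DS, tsum_eq_sum (s := T) (fun j hj => by simp [W₀, hj]), Finset.sum_map, Complex.ofReal_sum]
    refine Finset.sum_congr rfl fun p hp => ?_
    have : ((p, hc - 1) : D.P × ℕ) ∈ T := Finset.mem_map.mpr ⟨p, hp, rfl⟩
    change W₀ (p, hc - 1) * ((D.N p.1 ^ (hc - 1 + 1) : ℕ) : ℂ) ^ (-((1 / hc : ℝ) : ℂ)) = _
    rw [show W₀ (p, hc - 1) = 1 from if_pos this, one_mul, Nat.sub_add_cancel hc0, ← Complex.ofReal_neg, ← Complex.ofReal_natCast, ← Complex.ofReal_cpow (by positivity)]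
    congr 1
    rw [Nat.cast_pow, ← Real.rpow_natCast, ← Real.rpow_mul (by positivity), ← Real.rpow_neg_one]
    congr 1
    field_simp
  rw [e0] at key
  have := (Complex.nonneg_iff.mp key).1
  rw [Complex.sub_re, Complex.ofReal_re] at this
  linarith

lemma lim_ell (χ : G →* ℂˣ) :
    Tendsto (fun x : ℝ => ((x : ℂ) - 1) * deriv (D.ell (fun g => (χ g : ℂ))) x) (𝓝[>] 1) (𝓝 (-(ee χ : ℂ))) := by
  have t1 : Tendsto (fun x : ℝ => ((x : ℂ) - 1) * (deriv (D.Lam χ) x / D.Lam χ x) - ee χ) (𝓝[>] 1)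
      (𝓝 ((1 - 1) * (deriv (D.Lam χ) 1 / D.Lam χ 1) - ee χ)) := by
    refine Tendsto.sub_const (Tendsto.mul (tendsto_real.sub_const 1) (Tendsto.div ?_ ?_ (D.nonvanish χ))) _
    · exact (D.Lam_analytic χ).deriv.continuousAt.tendsto.comp tendsto_real
    · exact (D.Lam_analytic χ).continuousAt.tendsto.comp tendsto_real
  have e : (1 - 1) * (deriv (D.Lam χ) 1 / D.Lam χ 1) - (ee χ : ℂ) = -(ee χ : ℂ) := by ring
  rw [e] at t1
  refine t1.congr' ?_
  filter_upwards [self_mem_nhdsWithin] with x hx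
  have hx' : 1 < (x : ℂ).re := by simpa using hx
  have hx1 : (x : ℂ) - 1 ≠ 0 := by
    rw [sub_ne_zero]; intro h
    have : x = 1 := by exact_mod_cast h
    rw [this] at hx; simp at hx
  have ea : D.Lam χ =ᶠ[𝓝 (x : ℂ)] fun s => (s - 1) ^ ee χ * Complex.exp (D.ell (fun g => (χ g : ℂ)) s) := by
    filter_upwards [(isOpen_halfplane 1).mem_nhds hx'] with s hs
    rw [D.Lam_eq χ hs, D.exp_ell χ hs]
  have hd := (D.ell_analytic (fun g => (χ g : ℂ)) hx').differentiableAt.hasDerivAt.cexp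
  have hd2 : HasDerivAt (fun s : ℂ => (s - 1) ^ ee χ) ((ee χ : ℂ) * ((x : ℂ) - 1) ^ (ee χ - 1) * 1) (x : ℂ) :=
    ((hasDerivAt_id (x : ℂ)).sub_const 1).pow (ee χ)
  rw [ea.deriv_eq, (hd2.fun_mul hd).deriv, ea.eq_of_nhds]
  have hexp := Complex.exp_ne_zero (D.ell (fun g => (χ g : ℂ)) x)
  unfold ee
  split_ifs
  · field_simp; simp
  · field_simp; simp

theorem exists_prime (g : G) : ∃ p : D.P, D.gp p = g ∧ (D.N p.1).Prime := by
  classical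
  by_contra! H
  let c : G → ℂ := fun a => if a = g then 1 else 0
  have hsum : ∀ x : ℝ, 3 / 4 < x → Summable fun j => ‖D.wt c j‖ * (D.mm j : ℝ) ^ (-x) := by
    intro x hx
    let A : D.P × ℕ → ℝ := fun j => if j.2 = 0 ∧ D.gp j.1 = g then (D.N j.1.1 : ℝ) ^ (-x) else 0
    let B : D.P × ℕ → ℝ := fun j => (D.N j.1.1 : ℝ) ^ (-(2 * x)) * (2 ^ x * (2 ^ (-x)) ^ j.2)
    have hA : Summable A := by
      let e : {p : R // Prime p ∧ D.cl p ≠ 0 ∧ ¬ (D.N p).Prime} → D.P × ℕ := fun p => (⟨p.1, p.2.1, p.2.2.1⟩, 0)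
      have he : Function.Injective e := by
        intro p q h
        exact Subtype.ext (congrArg (fun z => z.1.1) h)
      rw [← he.summable_iff]
      · refine Summable.of_nonneg_of_le (fun p => ?_) (fun p => ?_) (D.hdeg x hx)
        · simp only [Function.comp, A]; split_ifs <;> positivity
        · simp only [Function.comp, A, e]; split_ifs
          · exact le_rfl
          · positivity
      · intro j hj
        simp only [A]
        rw [if_neg]
        rintro ⟨h1, h2⟩
        apply hj
        exact ⟨⟨j.1.1, j.1.2.1, j.1.2.2, H j.1 h2⟩, Prod.ext rfl h1.symm⟩
    have h2x : (2 : ℝ) ^ (-x) < 1 := Real.rpow_lt_one_of_one_lt_of_neg (by norm_num) (by linarith)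
    have hB : Summable B := by
      refine Summable.mul_of_nonneg (f := fun p : D.P => (D.N p.1 : ℝ) ^ (-(2 * x))) (g := fun k : ℕ => 2 ^ x * ((2 : ℝ) ^ (-x)) ^ k) ?_ ?_ ?_ ?_
      · have := (D.psum (x := 2 * x) (by linarith)).comp_injective (i := fun p : D.P => (p, 0)) (fun p q h => (Prod.mk.inj h).1)
        refine this.congr fun p => by simp
      · exact (summable_geometric_of_lt_one (by positivity) h2x).mul_left _
      · intro p; positivity
      · intro k; positivity
    have hAn : ∀ j, 0 ≤ A j := fun j => by simp only [A]; split_ifs <;> positivity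
    refine Summable.of_nonneg_of_le (fun j => by positivity) (fun j => ?_) (hA.add hB)
    have hBn : 0 ≤ B j := by simp only [B]; positivity
    have hcn : ∀ a, ‖c a‖ ≤ 1 := fun a => by simp only [c]; split_ifs <;> simp
    obtain ⟨p, k⟩ := j
    rcases k with _ | k
    · refine le_trans ?_ (le_add_of_nonneg_right hBn)
      by_cases hg : D.gp p = g
      · simp [wt, c, A, hg, mm]
      · simp [wt, c, A, hg]
    · refine le_trans ?_ (le_add_of_nonneg_left (hAn _))
      have h2 : (2 : ℝ) ≤ D.N p.1 := by exact_mod_cast D.two_le_N p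
      have hp0 : (0 : ℝ) < D.N p.1 := by linarith
      have h1 : 1 ≤ ‖(((k + 1 : ℕ) : ℂ) + 1 : ℂ)‖ := by
        have : (((k + 1 : ℕ) : ℂ) + 1 : ℂ) = ((k + 1 + 1 : ℕ) : ℂ) := by push_cast; rfl
        rw [this, Complex.norm_natCast]
        exact_mod_cast Nat.le_add_left 1 (k + 1)
      have hw : ‖D.wt c (p, k + 1)‖ ≤ 1 := by
        rw [wt, norm_div]
        exact (div_le_self (norm_nonneg _) h1).trans (hcn _)
      have e1 : (D.mm (p, k + 1) : ℝ) ^ (-x) = (D.N p.1 : ℝ) ^ (-(2 * x)) * ((D.N p.1 : ℝ) ^ (-x)) ^ k := by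
        rw [mm, Nat.cast_pow, ← Real.rpow_natCast, ← Real.rpow_natCast, ← Real.rpow_mul hp0.le,
          ← Real.rpow_mul hp0.le, ← Real.rpow_add hp0]
        congr 1; push_cast; ring
      have e2 : (2 : ℝ) ^ x * ((2 : ℝ) ^ (-x)) ^ (k + 1) = ((2 : ℝ) ^ (-x)) ^ k := by
        rw [pow_succ, mul_left_comm, ← Real.rpow_add (by norm_num)]; simp
      calc ‖D.wt c (p, k + 1)‖ * (D.mm (p, k + 1) : ℝ) ^ (-x) ≤ 1 * (D.mm (p, k + 1) : ℝ) ^ (-x) := by gcongr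
        _ = (D.N p.1 : ℝ) ^ (-(2 * x)) * ((D.N p.1 : ℝ) ^ (-x)) ^ k := by rw [one_mul, e1]
        _ ≤ (D.N p.1 : ℝ) ^ (-(2 * x)) * ((2 : ℝ) ^ (-x)) ^ k := by
          have h3 : (D.N p.1 : ℝ) ^ (-x) ≤ (2 : ℝ) ^ (-x) := Real.rpow_le_rpow_of_nonpos (by norm_num) h2 (by linarith)
          have h4 := pow_le_pow_left₀ (Real.rpow_nonneg hp0.le (-x)) h3 k
          exact mul_le_mul_of_nonneg_left h4 (by positivity)
        _ = B (p, k + 1) := by simp only [B]; rw [e2]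
  have han : AnalyticAt ℂ (D.ell c) 1 := DS_analyticAt _ _ D.Npow_ne (3 / 4) hsum (by norm_num)
  have l1 : Tendsto (fun x : ℝ => (Fintype.card G : ℂ) * (((x : ℂ) - 1) * deriv (D.ell c) x)) (𝓝[>] 1) (𝓝 0) := by
    have := ((tendsto_real.sub_const 1).mul (han.deriv.continuousAt.tendsto.comp tendsto_real)).const_mul (Fintype.card G : ℂ)
    simpa using this
  have l2 : Tendsto (fun x : ℝ => ∑ χ : G →* ℂˣ, (χ g⁻¹ : ℂ) * (((x : ℂ) - 1) * deriv (D.ell (fun g => (χ g : ℂ))) x))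
      (𝓝[>] 1) (𝓝 (∑ χ : G →* ℂˣ, (χ g⁻¹ : ℂ) * (-(ee χ : ℂ)))) :=
    tendsto_finsetSum _ fun χ _ => (D.lim_ell χ).const_mul _
  have e2 : (∑ χ : G →* ℂˣ, (χ g⁻¹ : ℂ) * (-(ee χ : ℂ))) = -1 := by
    rw [Finset.sum_eq_single 1]
    · simp [ee]
    · intro χ _ h; simp [ee, h]
    · simp
  rw [e2] at l2
  have e3 : ∀ s : ℂ, 1 < s.re → (Fintype.card G : ℂ) * D.ell c s =
      ∑ χ : G →* ℂˣ, (χ g⁻¹ : ℂ) * D.ell (fun g => (χ g : ℂ)) s := by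
    intro s hs
    simp_rw [← D.ell_mul]
    rw [D.ell_sum Finset.univ (fun (χ : G →* ℂˣ) a => (χ g⁻¹ : ℂ) * (χ a : ℂ)) hs]
    congr 1
    ext a
    have := csum (g⁻¹ * a)
    simp only [map_mul, Units.val_mul] at this
    rw [this]
    simp only [c, inv_mul_eq_one, eq_comm (a := g)]
    split_ifs <;> simp
  have l3 := l1.congr' (f₂ := fun x : ℝ => ∑ χ : G →* ℂˣ, (χ g⁻¹ : ℂ) * (((x : ℂ) - 1) * deriv (D.ell (fun g => (χ g : ℂ))) x)) (by
    filter_upwards [self_mem_nhdsWithin] with x hx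
    have hx' : 1 < (x : ℂ).re := by simpa using hx
    have ea : (fun s => (Fintype.card G : ℂ) * D.ell c s) =ᶠ[𝓝 (x : ℂ)]
      fun s => ∑ χ : G →* ℂˣ, (χ g⁻¹ : ℂ) * D.ell (fun g => (χ g : ℂ)) s := by
      filter_upwards [(isOpen_halfplane 1).mem_nhds hx'] with s hs
      exact e3 s hs
    have d1 := ((D.ell_analytic c hx').differentiableAt.hasDerivAt.const_mul (Fintype.card G : ℂ)).deriv
    have d2 := (HasDerivAt.fun_sum (u := Finset.univ) fun (χ : G →* ℂˣ) _ =>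
      ((D.ell_analytic (fun g => (χ g : ℂ)) hx').differentiableAt.hasDerivAt.const_mul (χ g⁻¹ : ℂ))).deriv
    have := ea.deriv_eq
    rw [d1, d2] at this
    rw [mul_left_comm, this, Finset.mul_sum]
    exact Finset.sum_congr rfl fun χ _ => by ring)
  have := tendsto_nhds_unique l3 l2
  norm_num at this
end HData
end Weber


namespace Weber
set_option linter.unusedSectionVars false
open Filter Topology

section Ray
variable {O : Type*} [CommRing O] [IsDedekindDomain O] 
variable (M : Ideal O)

/-- ideals coprime to M -/
def cop : Submonoid (Ideal O) where
  carrier := {a | IsCoprime a M}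
  one_mem' := isCoprime_one_left
  mul_mem' ha hb := IsCoprime.mul_left ha hb

def one_mod (α : O) : Prop := α - 1 ∈ M

variable {M}
lemma one_mod_one : one_mod M 1 := by simp [one_mod]
lemma one_mod.mul {α β : O} (h1 : one_mod M α) (h2 : one_mod M β) : one_mod M (α * β) := by
  have : α * β - 1 = (α - 1) * β + (β - 1) := by ring
  rw [one_mod, this]
  exact M.add_mem (M.mul_mem_right _ h1) h2

lemma one_mod.ne_zero {α : O} (hM : M ≠ ⊤) (h : one_mod M α) : α ≠ 0 := by
  rintro rfl
  apply hM
  rw [one_mod, zero_sub, M.neg_mem_iff] at h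
  exact M.eq_top_of_isUnit_mem h isUnit_one

lemma one_mod.cop {α : O} (h : one_mod M α) : Ideal.span {α} ∈ cop M := by
  change IsCoprime _ _
  rw [Ideal.isCoprime_iff_exists]
  exact ⟨α, Ideal.mem_span_singleton_self α, 1 - α, by rw [← M.neg_mem_iff, neg_sub]; exact h, by ring⟩

variable (M) in
/-- ray equivalence -/
def rayCon : Con (cop M) where
  r a b := ∃ β γ : O, one_mod M β ∧ one_mod M γ ∧ Ideal.span {β} * a.1 = Ideal.span {γ} * b.1
  iseqv :=
    { refl := fun a => ⟨1, 1, one_mod_one, one_mod_one, rfl⟩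
      symm := fun ⟨β, γ, h1, h2, h⟩ => ⟨γ, β, h2, h1, h.symm⟩
      trans := by
        rintro a b c ⟨β, γ, h1, h2, h⟩ ⟨β', γ', h1', h2', h'⟩
        refine ⟨β * β', γ * γ', h1.mul h1', h2.mul h2', ?_⟩
        rw [← Ideal.span_singleton_mul_span_singleton, ← Ideal.span_singleton_mul_span_singleton, mul_right_comm, h,
          mul_right_comm, mul_assoc, h', mul_assoc] }
  mul' := by
    rintro a b c d ⟨β, γ, h1, h2, h⟩ ⟨β', γ', h1', h2', h'⟩
    refine ⟨β * β', γ * γ', h1.mul h1', h2.mul h2', ?_⟩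
    rw [← Ideal.span_singleton_mul_span_singleton, ← Ideal.span_singleton_mul_span_singleton]
    change _ * (a.1 * c.1) = _ * (b.1 * d.1)
    rw [mul_mul_mul_comm, h, h', mul_mul_mul_comm]

variable (M) in
abbrev RayQ := (rayCon M).Quotient

variable (M) in
def rmk : cop M →* RayQ M := (rayCon M).mk'

lemma rmk_surj : Function.Surjective (rmk M) := Con.mk'_surjective

lemma rmk_eq {a b : cop M} : rmk M a = rmk M b ↔
    ∃ β γ : O, one_mod M β ∧ one_mod M γ ∧ Ideal.span {β} * a.1 = Ideal.span {γ} * b.1 := (rayCon M).eq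

lemma rmk_eq_one (hM : M ≠ ⊤) {a : cop M} : rmk M a = 1 ↔ ∃ α, one_mod M α ∧ a.1 = Ideal.span {α} := by
  rw [← map_one (rmk M), rmk_eq]
  constructor
  · rintro ⟨β, γ, h1, h2, h⟩
    rw [OneMemClass.coe_one, mul_one] at h
    have hd : γ ∈ Ideal.span {β} := by
      have : γ ∈ Ideal.span {γ} := Ideal.mem_span_singleton_self γ
      rw [← h] at this
      exact (Ideal.mul_le_left : Ideal.span {β} * a.1 ≤ Ideal.span {β}) this
    obtain ⟨α, rfl⟩ := Ideal.mem_span_singleton.mp hd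
    refine ⟨α, ?_, ?_⟩
    · have e : α - 1 = (β * α - 1) - (β - 1) * α := by ring
      rw [one_mod, e]
      exact M.sub_mem h2 (M.mul_mem_right _ h1)
    · rw [← Ideal.span_singleton_mul_span_singleton] at h
      have h0 : Ideal.span {β} ≠ 0 := by
        rw [Ideal.zero_eq_bot, Ne, Ideal.span_singleton_eq_bot]; exact h1.ne_zero hM
      exact mul_left_cancel₀ h0 h
  · rintro ⟨α, h, e⟩
    refine ⟨1, α, one_mod_one, h, ?_⟩
    rw [OneMemClass.coe_one, e, mul_one, Ideal.span_singleton_one, ← Ideal.one_eq_top, one_mul]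

lemma cop_span_iff {α : O} : Ideal.span {α} ∈ cop M ↔ IsUnit (Ideal.Quotient.mk M α) := by
  change IsCoprime _ _ ↔ _
  rw [Ideal.isCoprime_iff_exists]
  constructor
  · rintro ⟨i, hi, j, hj, h⟩
    obtain ⟨k, rfl⟩ := Ideal.mem_span_singleton.mp hi
    refine IsUnit.of_mul_eq_one (Ideal.Quotient.mk M k) ?_
    rw [← map_mul, ← map_one (Ideal.Quotient.mk M), Ideal.Quotient.eq, ← h]
    rw [sub_add_eq_sub_sub, sub_self, zero_sub]; exact M.neg_mem hj
  · intro h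
    obtain ⟨k, hk⟩ := h.exists_right_inv
    obtain ⟨k, rfl⟩ := Ideal.Quotient.mk_surjective k
    rw [← map_mul, ← map_one (Ideal.Quotient.mk M), Ideal.Quotient.eq] at hk
    exact ⟨α * k, Ideal.mem_span_singleton.mpr (dvd_mul_right _ _), 1 - α * k, by rw [← M.neg_mem_iff]; simpa using hk, by ring⟩

lemma cop_ne_zero (hM : M ≠ ⊤) (a : cop M) : a.1 ≠ 0 := by
  intro h
  have : IsCoprime a.1 M := a.2
  rw [h, isCoprime_zero_left, Ideal.isUnit_iff] at this
  exact hM this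

variable [Finite (ClassGroup O)] [Finite (O ⧸ M)]

lemma exists_inv (hM : M ≠ ⊤) (a : cop M) : ∃ b : cop M, ∃ α, one_mod M α ∧ b.1 * a.1 = Ideal.span {α} := by
  have ha := cop_ne_zero hM a
  let a' : nonZeroDivisors (Ideal O) := ⟨a.1, mem_nonZeroDivisors_of_ne_zero ha⟩
  have h1 : ClassGroup.mk0 (a' ^ Nat.card (ClassGroup O)) = 1 := by rw [map_pow, pow_card_eq_one']
  rw [ClassGroup.mk0_eq_one_iff] at h1
  obtain ⟨α, hα⟩ := h1
  have hα' : a.1 ^ Nat.card (ClassGroup O) = Ideal.span {α} := hα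
  have hc : Ideal.span {α} ∈ cop M := by rw [← hα']; exact pow_mem a.2 _
  obtain ⟨u, hu⟩ := cop_span_iff.mp hc
  have : Finite (O ⧸ M)ˣ := inferInstance
  have hn : (Ideal.Quotient.mk M α) ^ Nat.card (O ⧸ M)ˣ = 1 := by
    rw [← hu, ← Units.val_pow_eq_pow_val, pow_card_eq_one', Units.val_one]
  set n := Nat.card (O ⧸ M)ˣ
  set h := Nat.card (ClassGroup O)
  have hpos : 0 < h * n := Nat.mul_pos Nat.card_pos Nat.card_pos
  refine ⟨a ^ (h * n - 1), α ^ n, ?_, ?_⟩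
  · rw [one_mod, ← Ideal.Quotient.eq, map_pow, hn, map_one]
  · rw [SubmonoidClass.coe_pow, ← pow_succ, Nat.sub_add_cancel hpos, pow_mul, hα', Ideal.span_singleton_pow]

/-- the group structure -/
@[reducible]
noncomputable def rayGroup (hM : M ≠ ⊤) : CommGroup (RayQ M) :=
  have H : ∀ q : RayQ M, ∃ r : RayQ M, r * q = 1 := by
    intro q
    obtain ⟨a, rfl⟩ := rmk_surj q
    obtain ⟨b, α, h1, h2⟩ := exists_inv hM a
    exact ⟨rmk M b, by rw [← map_mul, rmk_eq_one hM]; exact ⟨α, h1, h2⟩⟩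
  { (inferInstance : CommMonoid (RayQ M)) with
    inv := fun q => (H q).choose
    inv_mul_cancel := fun q => (H q).choose_spec }

lemma ray_finite (hM : M ≠ ⊤) : Finite (RayQ M) := by
  let _ := rayGroup hM
  -- map to the class group
  let F : cop M →* ClassGroup O :=
    { toFun := fun a => ClassGroup.mk0 ⟨a.1, mem_nonZeroDivisors_of_ne_zero (cop_ne_zero hM a)⟩
      map_one' := by
        rw [← map_one ClassGroup.mk0]; rfl
      map_mul' := fun a b => by rw [← map_mul]; rfl }
  have hF1 : ∀ a : cop M, F a = 1 ↔ ∃ α, a.1 = Ideal.span {α} := by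
    intro a
    change ClassGroup.mk0 _ = 1 ↔ _
    rw [ClassGroup.mk0_eq_one_iff]
    exact ⟨fun ⟨α, h⟩ => ⟨α, h⟩, fun ⟨α, h⟩ => ⟨α, h⟩⟩
  have hF : ∀ a b : cop M, rmk M a = rmk M b → F a = F b := by
    intro a b h
    obtain ⟨β, γ, h1, h2, h⟩ := rmk_eq.mp h
    have e1 : F ⟨_, h1.cop⟩ = 1 := (hF1 _).mpr ⟨β, rfl⟩
    have e2 : F ⟨_, h2.cop⟩ = 1 := (hF1 _).mpr ⟨γ, rfl⟩
    have e3 : (⟨_, h1.cop⟩ : cop M) * a = ⟨_, h2.cop⟩ * b := Subtype.ext h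
    have := congrArg F e3
    rwa [map_mul, map_mul, e1, e2, one_mul, one_mul] at this
  -- principal classes
  classical
  let pr : O ⧸ M → RayQ M := fun z =>
    if h : ∃ α, Ideal.Quotient.mk M α = z ∧ Ideal.span {α} ∈ cop M then rmk M ⟨_, h.choose_spec.2⟩ else 1
  have hpr : ∀ a : cop M, F a = 1 → rmk M a ∈ Set.range pr := by
    intro a ha
    obtain ⟨α, hα⟩ := (hF1 a).mp ha
    have hc : Ideal.span {α} ∈ cop M := by rw [← hα]; exact a.2
    have h : ∃ α', Ideal.Quotient.mk M α' = Ideal.Quotient.mk M α ∧ Ideal.span {α'} ∈ cop M := ⟨α, rfl, hc⟩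
    refine ⟨Ideal.Quotient.mk M α, ?_⟩
    simp only [pr]
    rw [dif_pos h, rmk_eq]
    have hs := h.choose_spec
    set α' := h.choose
    obtain ⟨k, hk⟩ := (cop_span_iff.mp hc).exists_right_inv
    obtain ⟨k, rfl⟩ := Ideal.Quotient.mk_surjective k
    refine ⟨α * k, α' * k, ?_, ?_, ?_⟩
    · rw [one_mod, ← Ideal.Quotient.eq, map_mul, hk, map_one]
    · rw [one_mod, ← Ideal.Quotient.eq, map_mul, hs.1, hk, map_one]
    · simp only [hα, Ideal.span_singleton_mul_span_singleton]
      congr 2; ring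
  let F' : RayQ M → ClassGroup O := fun q => F (rmk_surj q).choose
  have hF' : ∀ a, F' (rmk M a) = F a := fun a => hF _ _ (rmk_surj (rmk M a)).choose_spec
  refine Set.finite_univ_iff.mp (Set.Finite.of_finite_fibers F' (Set.toFinite _) fun y _ => Set.Finite.subset ?_ Set.inter_subset_right)
  by_cases hy : (F' ⁻¹' {y}).Nonempty
  · obtain ⟨q₀, hq₀⟩ := hy
    obtain ⟨a₀, rfl⟩ := rmk_surj q₀
    obtain ⟨b₀, hb₀⟩ := rmk_surj (rmk M a₀)⁻¹
    refine ((Set.finite_range pr).image (fun z => rmk M a₀ * z)).subset ?_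
    intro q hq
    obtain ⟨a, rfl⟩ := rmk_surj q
    have e1 : F a = F a₀ := by rw [← hF', ← hF']; exact hq.trans hq₀.symm
    have e2 : F (b₀ * a) = 1 := by
      rw [map_mul, e1, ← map_mul, ← map_one F]
      apply hF
      rw [map_mul, hb₀, inv_mul_cancel, map_one]
    refine ⟨_, hpr _ e2, ?_⟩
    simp only [map_mul, hb₀]
    rw [mul_inv_cancel_left]
  · rw [Set.not_nonempty_iff_eq_empty.mp hy]; exact Set.finite_empty
end Ray
end Weber


namespace Weber
set_option linter.unusedSectionVars false
open Filter Topology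

section Quad
variable {O : Type*} [CommRing O] [IsDedekindDomain O] [Module.Free ℤ O] [Module.Finite ℤ O]

lemma countable_ideal [Countable O] : Countable (Ideal O) := by
  have : Function.Surjective (fun s : Finset O => Ideal.span (s : Set O)) := by
    intro I
    obtain ⟨s, hs⟩ := (IsNoetherian.noetherian I : I.FG)
    exact ⟨s, hs⟩
  exact this.countable

lemma countable_O : Countable O := by
  let b := Module.Free.chooseBasis ℤ O
  exact b.equivFun.toEquiv.countable_iff.mpr inferInstance

variable (O) in
/-- Data of an imaginary quadratic order embedded in the complex numbers -/
structure QD where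
  rank : Module.finrank ℤ O = 2
  φ : O →+* ℂ
  nrm : ∀ α : O, ((Algebra.norm ℤ α : ℤ) : ℝ) = Complex.normSq (φ α)
  om : O
  im : (φ om).im ≠ 0

namespace QD
variable (q : QD O)

noncomputable def bO : Module.Basis (Fin 2) ℤ O := Module.finBasisOfFinrankEq ℤ O q.rank

/-- the covolume of two elements -/
noncomputable def wd (x y : ℂ) : ℝ := (y * (starRingEnd ℂ) x).im

lemma absNorm_span (α : O) : (Ideal.absNorm (Ideal.span {α}) : ℝ) = Complex.normSq (q.φ α) := by
  rw [Ideal.absNorm_span_singleton, ← q.nrm, Nat.cast_natAbs]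
  have : 0 ≤ ((Algebra.norm ℤ α : ℤ) : ℝ) := by rw [q.nrm]; exact Complex.normSq_nonneg _
  have h : 0 ≤ Algebra.norm ℤ α := by exact_mod_cast this
  rw [abs_of_nonneg h]

lemma normSq_ge {α : O} (h : α ≠ 0) : 1 ≤ Complex.normSq (q.φ α) := by
  rw [← q.absNorm_span]
  have : Ideal.absNorm (Ideal.span {α}) ≠ 0 := by
    rw [Ne, Ideal.absNorm_eq_zero_iff, Ideal.span_singleton_eq_bot]; exact h
  exact_mod_cast Nat.one_le_iff_ne_zero.mpr this

lemma charZero (q : QD O) : CharZero O := by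
  refine charZero_of_inj_zero fun n h => ?_
  have := congrArg q.φ h
  simpa using this

/-- unit lemma -/
lemma unit_eq (q : QD O) {m : ℕ} (hm : 3 ≤ m) {α α' : O} (h : one_mod (Ideal.span {(m : O)}) α)
    (h' : one_mod (Ideal.span {(m : O)}) α') (hs : Ideal.span {α} = Ideal.span {α'}) 
    : α = α' := by
  rw [Ideal.span_singleton_eq_span_singleton] at hs
  obtain ⟨u, rfl⟩ := hs
  have h1 : (u : O) - 1 ∈ Ideal.span {(m : O)} := by
    have e : (u : O) - 1 = (α * u - 1) - (α - 1) * u := by ring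
    rw [e]
    exact Ideal.sub_mem _ h' (Ideal.mul_mem_right _ _ h)
  obtain ⟨z, hz⟩ := Ideal.mem_span_singleton.mp h1
  by_cases h0 : z = 0
  · rw [h0, mul_zero, sub_eq_zero] at hz
    rw [hz, mul_one]
  exfalso
  have hu : Complex.normSq (q.φ u) = 1 := by
    rw [← q.absNorm_span, Ideal.span_singleton_eq_top.mpr u.isUnit, Ideal.absNorm_top, Nat.cast_one]
  have hn := q.normSq_ge h0
  rw [Complex.normSq_eq_norm_sq] at hn hu
  have hu1 : ‖q.φ u‖ = 1 := by
    have := norm_nonneg (q.φ u); nlinarith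
  have hz1 : 1 ≤ ‖q.φ z‖ := by
    have := norm_nonneg (q.φ z); nlinarith
  have e := congrArg q.φ hz
  rw [map_sub, map_one, map_mul, map_natCast] at e
  have e2 := congrArg norm e
  rw [norm_mul, Complex.norm_natCast] at e2
  have e3 : ‖q.φ u - 1‖ ≤ 2 := by
    refine (norm_sub_le _ _).trans ?_
    rw [hu1, norm_one]; norm_num
  have : (3 : ℝ) ≤ m := by exact_mod_cast hm
  nlinarith

lemma wd_comb (x y : ℂ) (a b c d : ℤ) : wd (a * x + b * y) (c * x + d * y) = (a * d - b * c) * wd x y := by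
  simp only [wd, Complex.mul_im, Complex.conj_re, Complex.conj_im, Complex.add_re, Complex.add_im, Complex.mul_re, Complex.intCast_re, Complex.intCast_im]
  ring

noncomputable def ΔO : ℝ := |wd (q.φ (q.bO 0)) (q.φ (q.bO 1))|

lemma expand (α : O) : α = (q.bO.repr α 0) • q.bO 0 + (q.bO.repr α 1) • q.bO 1 := by
  conv_lhs => rw [← q.bO.sum_repr α, Fin.sum_univ_two]

lemma φ_expand (α : O) : q.φ α = (q.bO.repr α 0 : ℂ) * q.φ (q.bO 0) + (q.bO.repr α 1 : ℂ) * q.φ (q.bO 1) := by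
  conv_lhs => rw [q.expand α]
  simp

lemma ΔO_pos : 0 < q.ΔO := by
  rw [ΔO, abs_pos]
  intro h
  have := wd_comb (q.φ (q.bO 0)) (q.φ (q.bO 1)) (q.bO.repr 1 0) (q.bO.repr 1 1) (q.bO.repr q.om 0) (q.bO.repr q.om 1)
  rw [← q.φ_expand, ← q.φ_expand, h, mul_zero] at this
  apply q.im
  simpa [wd] using this

/-- covolume of an ideal -/
lemma wd_ideal (J : Ideal O) (e : Module.Basis (Fin 2) ℤ J) :
    |wd (q.φ (e 0)) (q.φ (e 1))| = Ideal.absNorm J * q.ΔO := by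
  have := Ideal.natAbs_det_basis_change q.bO J e
  rw [← this, Module.Basis.det_apply, Matrix.det_fin_two]
  rw [q.φ_expand (e 0), q.φ_expand (e 1), wd_comb, abs_mul, ΔO]
  simp only [Module.Basis.toMatrix_apply, Function.comp_apply]
  congr 1
  rw [Nat.cast_natAbs]
  push_cast
  congr 1
  ring

end QD
end Quad
end Weber


namespace Weber
set_option linter.unusedSectionVars false
open Filter Topology

section Quad
variable {O : Type*} [CommRing O] [IsDedekindDomain O] [Module.Free ℤ O] [Module.Finite ℤ O]
namespace QD

lemma absNorm_M (q : QD O) (m : ℕ) : Ideal.absNorm (Ideal.span {(m : O)}) = m ^ 2 := by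
  rw [Ideal.absNorm_span_natCast, q.rank]

lemma M_ne_top (q : QD O) {m : ℕ} (hm : 3 ≤ m) : Ideal.span {(m : O)} ≠ ⊤ := by
  intro h
  have := q.absNorm_M m
  rw [h, Ideal.absNorm_top] at this
  nlinarith

lemma M_ne_bot (q : QD O) {m : ℕ} (hm : 3 ≤ m) : Ideal.span {(m : O)} ≠ ⊥ := by
  intro h
  have := q.absNorm_M m
  rw [h, Ideal.absNorm_bot] at this
  nlinarith

lemma finite_M (q : QD O) {m : ℕ} (hm : 3 ≤ m) : Finite (O ⧸ Ideal.span {(m : O)}) := by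
  rw [← Ideal.absNorm_ne_zero_iff, q.absNorm_M]
  positivity

lemma param0 (q : QD O) (m : ℕ) (M : Ideal O) (hMt : M ≠ ⊤) (hMb : M ≠ ⊥) (hnM : Ideal.absNorm M = m ^ 2)
    (hu : ∀ α α' : O, one_mod M α → one_mod M α' → Ideal.span {α} = Ideal.span {α'} → α = α')
    (b : Ideal O) (hb : b ∈ cop M) :
    ∃ v e₁ e₂ : ℂ, |(e₂ * (starRingEnd ℂ) e₁).im| = Ideal.absNorm b * m ^ 2 * q.ΔO ∧
      ∃ F : ℤ × ℤ ≃ {a : Ideal O // ∃ α, one_mod M α ∧ a * b = Ideal.span {α}},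
        ∀ z, (Ideal.absNorm (F z).1 : ℝ) * Ideal.absNorm b = Complex.normSq (v + z.1 * e₁ + z.2 * e₂) := by
  have hb0 : b ≠ ⊥ := cop_ne_zero hMt ⟨b, hb⟩
  have hbM : IsCoprime b M := hb
  obtain ⟨α0, hα0, j, hj, hij⟩ := Ideal.isCoprime_iff_exists.mp hbM
  have h1 : one_mod M α0 := by
    have : α0 - 1 = - j := by rw [← hij]; ring
    rw [one_mod, this]; exact M.neg_mem hj
  have hJ : b * M ≠ ⊥ := by
    rw [← Ideal.zero_eq_bot]
    exact mul_ne_zero hb0 hMb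
  obtain ⟨e⟩ : Nonempty (Module.Basis (Fin 2) ℤ (b * M : Ideal O)) := ⟨(b * M).selfBasis q.bO hJ⟩
  let G : ℤ × ℤ → O := fun z => α0 + (z.1 • (e 0 : O) + z.2 • (e 1 : O))
  have hGmem : ∀ z : ℤ × ℤ, z.1 • (e 0 : O) + z.2 • (e 1 : O) ∈ b * M := fun z =>
    Ideal.add_mem _ (zsmul_mem (e 0).2 z.1) (zsmul_mem (e 1).2 z.2)
  have hGb : ∀ z, G z ∈ b := fun z => b.add_mem hα0 ((Ideal.mul_le_left : b * M ≤ b) (hGmem z))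
  have hG1 : ∀ z, one_mod M (G z) := fun z => by
    have : G z - 1 = (α0 - 1) + (z.1 • (e 0 : O) + z.2 • (e 1 : O)) := by simp only [G]; ring
    rw [one_mod, this]
    exact M.add_mem h1 ((Ideal.mul_le_right : b * M ≤ M) (hGmem z))
  have hGinj : Function.Injective G := by
    intro z w h
    have h' : z.1 • (e 0 : O) + z.2 • (e 1 : O) = w.1 • (e 0 : O) + w.2 • (e 1 : O) := add_left_cancel h
    have h2 : z.1 • e 0 + z.2 • e 1 = w.1 • e 0 + w.2 • e 1 := Subtype.ext (by simpa using h')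
    have h3 := congrArg e.repr h2
    have h4 := DFunLike.congr_fun h3 0
    have h5 := DFunLike.congr_fun h3 1
    simp at h4 h5
    exact Prod.ext h4 h5
  have hGsurj : ∀ α, α ∈ b → one_mod M α → ∃ z, G z = α := by
    intro α ha h
    have hm : α - α0 ∈ b * M := by
      rw [Ideal.mul_eq_inf_of_isCoprime hbM]
      refine ⟨b.sub_mem ha hα0, ?_⟩
      have : α - α0 = (α - 1) - (α0 - 1) := by ring
      rw [this]; exact M.sub_mem h h1
    refine ⟨(e.repr ⟨_, hm⟩ 0, e.repr ⟨_, hm⟩ 1), ?_⟩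
    have := e.sum_repr ⟨_, hm⟩
    rw [Fin.sum_univ_two] at this
    have h2 := congrArg Subtype.val this
    simp only [G]
    rw [eq_comm, ← sub_eq_iff_eq_add']
    exact h2.symm.trans (by simp)
  have hdv : ∀ z, ∃ a : Ideal O, a * b = Ideal.span {G z} := by
    intro z
    have : b ∣ Ideal.span {G z} := by
      rw [Ideal.dvd_iff_le, Ideal.span_singleton_le_iff_mem]; exact hGb z
    obtain ⟨a, ha⟩ := this
    exact ⟨a, by rw [mul_comm, ha]⟩
  choose f hf using hdv
  let F0 : ℤ × ℤ → {a : Ideal O // ∃ α, one_mod M α ∧ a * b = Ideal.span {α}} :=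
    fun z => ⟨f z, G z, hG1 z, hf z⟩
  have hF0 : Function.Bijective F0 := by
    constructor
    · intro z w h
      have h' : f z = f w := congrArg Subtype.val h
      apply hGinj
      apply hu _ _ (hG1 z) (hG1 w)
      rw [← hf, ← hf, h']
    · rintro ⟨a, α, h1, h2⟩
      have hab : α ∈ b := by
        have : α ∈ a * b := by rw [h2]; exact Ideal.mem_span_singleton_self α
        exact (Ideal.mul_le_right : a * b ≤ b) this
      obtain ⟨z, hz⟩ := hGsurj α hab h1
      refine ⟨z, Subtype.ext ?_⟩
      have : f z * b = a * b := by rw [hf, hz, h2]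
      exact mul_right_cancel₀ hb0 this
  refine ⟨q.φ α0, q.φ (e 0), q.φ (e 1), ?_, Equiv.ofBijective F0 hF0, ?_⟩
  · have := q.wd_ideal (b * M) e
    rw [wd] at this
    rw [this, map_mul, hnM]
    push_cast; ring
  · intro z
    have : (Ideal.absNorm (f z) : ℝ) * Ideal.absNorm b = Ideal.absNorm (Ideal.span {G z}) := by
      rw [← hf z, map_mul]; push_cast; rfl
    change (Ideal.absNorm (f z) : ℝ) * Ideal.absNorm b = _
    rw [this, q.absNorm_span]
    congr 1
    simp only [G, map_add, zsmul_eq_mul, map_mul, map_intCast]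
    ring

lemma param (q : QD O) {m : ℕ} (hm : 3 ≤ m) (b : Ideal O) (hb : b ∈ cop (Ideal.span {(m : O)})) :
    ∃ v e₁ e₂ : ℂ, |(e₂ * (starRingEnd ℂ) e₁).im| = Ideal.absNorm b * m ^ 2 * q.ΔO ∧
      ∃ F : ℤ × ℤ ≃ {a : Ideal O // ∃ α, one_mod (Ideal.span {(m : O)}) α ∧ a * b = Ideal.span {α}},
        ∀ z, (Ideal.absNorm (F z).1 : ℝ) * Ideal.absNorm b = Complex.normSq (v + z.1 * e₁ + z.2 * e₂) :=
  q.param0 m _ (q.M_ne_top hm) (q.M_ne_bot hm) (q.absNorm_M m) (fun _ _ h h' hs => q.unit_eq hm h h' hs) b hb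

end QD
end Quad
end Weber


namespace Weber
set_option linter.unusedSectionVars false
open Filter Topology

section Quad
variable {O : Type*} [CommRing O] [IsDedekindDomain O] [Module.Free ℤ O] [Module.Finite ℤ O]

section cl
variable {M : Ideal O} [Finite (ClassGroup O)] [Finite (O ⧸ M)]

lemma cop_mul_iff {a b : Ideal O} : a * b ∈ cop M ↔ a ∈ cop M ∧ b ∈ cop M := by
  change IsCoprime _ _ ↔ IsCoprime _ _ ∧ IsCoprime _ _
  exact IsCoprime.mul_left_iff

open Classical in
/-- class map extended by zero -/
noncomputable def clm (hM : M ≠ ⊤) : letI := rayGroup hM; Ideal O →*₀ WithZero (RayQ M) :=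
  letI := rayGroup hM
  { toFun := fun a => if h : a ∈ cop M then ((rmk M ⟨a, h⟩ : RayQ M) : WithZero (RayQ M)) else 0
    map_zero' := by
      rw [dif_neg]
      intro h
      exact cop_ne_zero hM ⟨_, h⟩ rfl
    map_one' := by
      rw [dif_pos (one_mem _)]
      have : (⟨1, one_mem _⟩ : cop M) = 1 := rfl
      rw [this, map_one]; rfl
    map_mul' := fun a b => by
      by_cases ha : a ∈ cop M
      · by_cases hb : b ∈ cop M
        · rw [dif_pos ha, dif_pos hb, dif_pos (mul_mem ha hb)]
          have : (⟨a * b, mul_mem ha hb⟩ : cop M) = ⟨a, ha⟩ * ⟨b, hb⟩ := rfl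
          rw [this, map_mul]; rfl
        · rw [dif_neg hb, mul_zero, dif_neg]
          exact fun h => hb (cop_mul_iff.mp h).2
      · rw [dif_neg ha, zero_mul, dif_neg]
        exact fun h => ha (cop_mul_iff.mp h).1 }

lemma clm_ne_zero (hM : M ≠ ⊤) {a : Ideal O} (h : clm hM a ≠ 0) : a ∈ cop M := by
  by_contra hc
  exact h (dif_neg hc)

lemma clm_pos (hM : M ≠ ⊤) {a : Ideal O} (h : a ∈ cop M) :
    clm hM a = ((rmk M ⟨a, h⟩ : RayQ M) : WithZero (RayQ M)) := dif_pos h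

lemma clm_iff (hM : M ≠ ⊤) (g : RayQ M) (b : cop M) (hg : rmk M b * g = 1) (a : Ideal O) :
    clm hM a = (g : WithZero (RayQ M)) ↔ ∃ α, one_mod M α ∧ a * b.1 = Ideal.span {α} := by
  let _ := rayGroup hM
  constructor
  · intro h
    have ha : a ∈ cop M := clm_ne_zero hM (by rw [h]; exact WithZero.coe_ne_zero)
    rw [clm_pos hM ha] at h
    have h' := WithZero.coe_injective h
    rw [← h', ← map_mul, rmk_eq_one hM] at hg
    obtain ⟨α, h1, h2⟩ := hg
    exact ⟨α, h1, by rw [← h2, mul_comm]; rfl⟩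
  · rintro ⟨α, h1, h2⟩
    have ha : a ∈ cop M := (cop_mul_iff.mp (h2 ▸ h1.cop : a * b.1 ∈ cop M)).1
    rw [clm_pos hM ha]
    congr 1
    have : rmk M b * rmk M ⟨a, ha⟩ = 1 := by
      rw [← map_mul, rmk_eq_one hM]
      exact ⟨α, h1, by rw [← h2, mul_comm]; rfl⟩
    exact mul_left_cancel (this.trans hg.symm)
end cl

namespace QD

lemma prime_inert (q : QD O) {P : Ideal O} (hP : Prime P) (hn : ¬ (Ideal.absNorm P).Prime) :
    ∃ r : ℕ, Ideal.absNorm P = r ^ 2 ∧ P = Ideal.span {(r : O)} := by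
  have hp : P.IsPrime := Ideal.isPrime_of_prime hP
  have hmax : P.IsMaximal := hp.isMaximal hP.ne_zero
  obtain ⟨r, n, hn0, hr, hrp, hN⟩ := Ideal.exists_prime_and_absNorm_eq_pow P
  have hd : P ∣ Ideal.span {(r : O)} := by
    rw [Ideal.dvd_iff_le, Ideal.span_singleton_le_iff_mem]; exact hr
  obtain ⟨a, ha⟩ := hd
  have h2 : r ^ 2 = r ^ n * Ideal.absNorm a := by
    rw [← q.absNorm_M, ha, map_mul, hN]
  have hn1 : n ≠ 1 := by
    rintro rfl
    rw [pow_one] at hN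
    exact hn (hN ▸ hrp)
  have hle : n ≤ 2 := (Nat.pow_dvd_pow_iff_le_right hrp.one_lt).mp ⟨_, h2⟩
  have hn2 : n = 2 := by omega
  subst hn2
  refine ⟨r, hN, ?_⟩
  have : Ideal.absNorm a = 1 := by
    have hpos : 0 < r ^ 2 := pow_pos hrp.pos 2
    nlinarith
  rw [Ideal.absNorm_eq_one_iff] at this
  rw [ha, this, Ideal.mul_top]

variable [Finite (ClassGroup O)]

lemma summ_deg (q : QD O) (S : Ideal O → Prop) (x : ℝ) (hx : 3 / 4 < x) :
    Summable fun p : {p : Ideal O // Prime p ∧ S p ∧ ¬ (Ideal.absNorm p).Prime} =>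
      (Ideal.absNorm p.1 : ℝ) ^ (-x) := by
  have H : ∀ p : {p : Ideal O // Prime p ∧ S p ∧ ¬ (Ideal.absNorm p).Prime},
      ∃ r : ℕ, Ideal.absNorm p.1 = r ^ 2 ∧ p.1 = Ideal.span {(r : O)} := fun p => q.prime_inert p.2.1 p.2.2.2
  choose f hf using H
  have hinj : Function.Injective f := by
    intro p p' h
    apply Subtype.ext
    rw [(hf p).2, (hf p').2, h]
  have hs : Summable fun n : ℕ => (n : ℝ) ^ (-(2 * x)) := by
    rw [Real.summable_nat_rpow]; linarith
  refine (hs.comp_injective hinj).congr fun p => ?_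
  simp only [Function.comp_apply]
  rw [(hf p).1, Nat.cast_pow, ← Real.rpow_natCast, ← Real.rpow_mul (Nat.cast_nonneg _)]
  congr 1; push_cast; ring

lemma class_theta (q : QD O) {m : ℕ} (hm : 3 ≤ m) (b : Ideal O) (hb : b ∈ cop (Ideal.span {(m : O)}))
    (S : Ideal O → Prop)
    (hS : ∀ a, S a ↔ ∃ α, one_mod (Ideal.span {(m : O)}) α ∧ a * b = Ideal.span {α}) :
    (∀ t : ℝ, 0 < t → Summable fun a : {a // S a} => Real.exp (-t * Ideal.absNorm a.1)) ∧
    ∃ C, ∀ t, 0 < t → t ≤ 1 → |th (fun a : {a // S a} => Ideal.absNorm a.1) t - (Real.pi / (m ^ 2 * q.ΔO)) / t| ≤ C := by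
  obtain ⟨v, e₁, e₂, hΔ, F, hF⟩ := q.param hm b hb
  have hNb : 1 ≤ (Ideal.absNorm b : ℝ) := by
    have : Ideal.absNorm b ≠ 0 := by
      rw [Ne, Ideal.absNorm_eq_zero_iff]
      exact cop_ne_zero (q.M_ne_top hm) ⟨b, hb⟩
    exact_mod_cast Nat.one_le_iff_ne_zero.mpr this
  have hm' : (0 : ℝ) < m := by exact_mod_cast (by omega : 0 < m)
  have hO := q.ΔO_pos
  set B : ℝ := (Ideal.absNorm b : ℝ)
  obtain ⟨h1, C, h2⟩ := theta2 v e₁ e₂ (B * m ^ 2 * q.ΔO) hΔ.symm (by positivity)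
  let E : ℤ × ℤ ≃ {a // S a} := F.trans (Equiv.subtypeEquivRight fun a => (hS a).symm)
  have hE : ∀ (t : ℝ) (z : ℤ × ℤ), Real.exp (-t * (Ideal.absNorm (E z).1 : ℝ)) =
      Real.exp (-(t / B) * Complex.normSq (v + z.1 * e₁ + z.2 * e₂)) := by
    intro t z
    rw [← hF z]
    congr 1
    have : (E z).1 = (F z).1 := rfl
    rw [this]
    field_simp
  constructor
  · intro t ht
    rw [← E.summable_iff]
    refine (h1 (t / B) (by positivity)).congr fun z => ?_
    exact (hE t z).symm
  · refine ⟨C, fun t ht ht1 => ?_⟩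
    have := h2 (t / B) (by positivity) (by rw [div_le_one (by positivity)]; linarith)
    rw [th, ← E.tsum_eq]
    simp only [hE]
    convert this using 3
    field_simp

theorem ray_prime (q : QD O) {m : ℕ} (hm : 3 ≤ m) (b : Ideal O) (hb : b ∈ cop (Ideal.span {(m : O)})) :
    ∃ (𝔭 : Ideal O) (α : O), (Ideal.absNorm 𝔭).Prime ∧ one_mod (Ideal.span {(m : O)}) α ∧ 𝔭 * b = Ideal.span {α} := by
  have hM := q.M_ne_top hm
  have := q.finite_M hm
  let _ := rayGroup hM
  have := ray_finite hM
  have : Fintype (RayQ (Ideal.span {(m : O)})) := Fintype.ofFinite _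
  have : Countable O := countable_O
  have : Countable (Ideal O) := countable_ideal
  have key : ∀ g : RayQ (Ideal.span {(m : O)}), ∃ b : cop (Ideal.span {(m : O)}), rmk _ b * g = 1 := by
    intro g
    obtain ⟨b, hb⟩ := rmk_surj g⁻¹
    exact ⟨b, by rw [hb, inv_mul_cancel]⟩
  have key2 : ∀ g, _ := fun g => q.class_theta hm (key g).choose.1 (key g).choose.2
    (fun a => clm hM a = (g : WithZero (RayQ (Ideal.span {(m : O)})))) (clm_iff hM g _ (key g).choose_spec)
  have hm' : (0 : ℝ) < m := by exact_mod_cast (by omega : 0 < m)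
  have hO := q.ΔO_pos
  let D : HData (Ideal O) (RayQ (Ideal.span {(m : O)})) :=
    { N := Ideal.absNorm
      cl := clm hM
      hN := fun a ha => by
        rw [Ne, Ideal.absNorm_eq_zero_iff]
        exact cop_ne_zero hM ⟨a, clm_ne_zero hM ha⟩
      hth := fun g => (key2 g).1
      κ := Real.pi / (m ^ 2 * q.ΔO)
      hκ := by positivity
      hC := fun g => (key2 g).2
      hdeg := fun x hx => q.summ_deg (fun p => clm hM p ≠ 0) x hx }
  obtain ⟨p, hp, hpp⟩ := D.exists_prime (rmk _ ⟨b, hb⟩)⁻¹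
  have h1 := D.gp_spec p
  rw [hp] at h1
  obtain ⟨α, h2, h3⟩ := (clm_iff hM _ ⟨b, hb⟩ (mul_inv_cancel _) p.1).mp h1
  exact ⟨p.1, α, hpp, h2, h3⟩

end QD
end Quad
end Weber


namespace Weber
set_option linter.unusedSectionVars false
open QuadraticAlgebra NumberField

section KK
variable {s b : ℤ}

abbrev KK (s b : ℤ) := QuadraticAlgebra ℚ (s : ℚ) (b : ℚ)

lemma KK_fact (hD : b ^ 2 + 4 * s < 0) : Fact (∀ r : ℚ, r ^ 2 ≠ (s : ℚ) + b * r) := by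
  refine ⟨fun r h => ?_⟩
  have : (b : ℚ) ^ 2 + 4 * s < 0 := by exact_mod_cast hD
  nlinarith [sq_nonneg (2 * r - b)]

variable [Fact (∀ r : ℚ, r ^ 2 ≠ (s : ℚ) + b * r)]

instance KK_nf : NumberField (KK s b) where
  to_charZero := inferInstance
  to_finiteDimensional := by
    have : Module.Finite ℚ (KK s b) := inferInstance
    convert this

lemma int_of_integral (r : ℚ) (h : IsIntegral ℤ (⟨r, 0⟩ : KK s b)) : ∃ n : ℤ, r = n := by
  have h1 : IsIntegral ℤ r := (isIntegral_algebraMap_iff (QuadraticAlgebra.algebraMap_injective)).mp h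
  obtain ⟨n, hn⟩ := IsIntegrallyClosed.isIntegral_iff.mp h1
  exact ⟨n, by rw [← hn]; rfl⟩

lemma trace_int {x : KK s b} (h : IsIntegral ℤ x) : ∃ n : ℤ, 2 * x.re + b * x.im = n := by
  apply int_of_integral (s := s) (b := b)
  have : (⟨2 * x.re + b * x.im, 0⟩ : KK s b) = x + star x := by
    ext <;> simp
    ring
  rw [this]
  refine h.add ?_
  exact h.map ((starRingEnd (KK s b)).toIntAlgHom)

lemma omega_int : IsIntegral ℤ (ω : KK s b) := by
  refine ⟨Polynomial.X ^ 2 - Polynomial.C b * Polynomial.X - Polynomial.C s, ?_, ?_⟩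
  · monicity!
  · simp only [Polynomial.eval₂_sub, Polynomial.eval₂_mul, Polynomial.eval₂_X, Polynomial.eval₂_C, sq]
    ext <;> simp

/-- coercion to the field -/
abbrev cc : 𝓞 (KK s b) →+* KK s b := algebraMap (𝓞 (KK s b)) (KK s b)

lemma cc_inj {x y : 𝓞 (KK s b)} (h : cc x = cc y) : x = y := RingOfIntegers.ext h

/-- the generator in the ring of integers -/
noncomputable def ww (s b : ℤ) [Fact (∀ r : ℚ, r ^ 2 ≠ (s : ℚ) + b * r)] : 𝓞 (KK s b) := ⟨ω, omega_int⟩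

lemma ww_coe : cc (ww s b : 𝓞 (KK s b)) = ω := rfl

lemma ww_sq : ww s b * ww s b = s + b * ww s b := by
  apply cc_inj
  simp only [map_mul, map_add, ww_coe, map_intCast]
  ext <;> simp

lemma trace_int' (x : 𝓞 (KK s b)) : ∃ n : ℤ, 2 * (cc x).re + b * (cc x).im = n :=
  trace_int (RingOfIntegers.isIntegral_coe x)

lemma disc_mul (x : 𝓞 (KK s b)) : ∃ u v : ℤ, ((b ^ 2 + 4 * s : ℤ) : 𝓞 (KK s b)) * x = u + v * ww s b ∧
    ((b ^ 2 + 4 * s : ℤ) : ℚ) * (cc x).re = u ∧ ((b ^ 2 + 4 * s : ℤ) : ℚ) * (cc x).im = v := by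
  obtain ⟨T, hT⟩ := trace_int' x
  obtain ⟨U, hU⟩ := trace_int' (x * ww s b)
  rw [map_mul, ww_coe] at hU
  simp at hU
  have h1 : ((b ^ 2 + 4 * s : ℤ) : ℚ) * (cc x).re = (((b ^ 2 + 2 * s) * T - b * U : ℤ) : ℚ) := by
    push_cast
    rw [← hT, ← hU]; ring
  have h2 : ((b ^ 2 + 4 * s : ℤ) : ℚ) * (cc x).im = ((2 * U - b * T : ℤ) : ℚ) := by
    push_cast
    rw [← hT, ← hU]; ring
  refine ⟨_, _, ?_, h1, h2⟩
  generalize (b ^ 2 + 2 * s) * T - b * U = u at h1 ⊢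
  generalize 2 * U - b * T = v at h2 ⊢
  generalize b ^ 2 + 4 * s = D at h1 h2 ⊢
  apply cc_inj
  rw [map_add, map_mul, map_mul, ww_coe, map_intCast, map_intCast, map_intCast]
  ext
  · simpa using h1
  · simpa using h2

lemma norm_KK (x : KK s b) : Algebra.norm ℚ x = x.re ^ 2 + b * x.re * x.im - s * x.im ^ 2 := by
  have : Algebra.norm ℚ x = QuadraticAlgebra.norm x := by
    rw [← det_toLinearMap_eq_norm, Algebra.norm_apply]
    rfl
  rw [this, norm_def]; ring

lemma norm_int (x : 𝓞 (KK s b)) : ((Algebra.norm ℤ x : ℤ) : ℚ) =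
    (cc x).re ^ 2 + b * (cc x).re * (cc x).im - s * (cc x).im ^ 2 := by
  rw [Algebra.coe_norm_int, norm_KK]

noncomputable def rt (s b : ℤ) : ℝ := Real.sqrt (-((b : ℝ) ^ 2 + 4 * s))

lemma rt_sq (hD : b ^ 2 + 4 * s < 0) : rt s b * rt s b = -((b : ℝ) ^ 2 + 4 * s) := by
  have h : ((b : ℝ) ^ 2 + 4 * s) < 0 := by exact_mod_cast hD
  exact Real.mul_self_sqrt (by linarith : 0 ≤ -((b : ℝ) ^ 2 + 4 * s))

noncomputable def theta (s b : ℤ) : ℂ := ⟨b / 2, rt s b / 2⟩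

lemma theta_sq (hD : b ^ 2 + 4 * s < 0) : theta s b * theta s b = (s : ℚ) • (1 : ℂ) + (b : ℚ) • theta s b := by
  have h2 := rt_sq hD
  rw [Rat.smul_def, Rat.smul_def]
  apply Complex.ext
  · simp [theta]
    linarith
  · simp [theta]
    ring

/-- the embedding -/
noncomputable def emb (hD : b ^ 2 + 4 * s < 0) : KK s b →ₐ[ℚ] ℂ := QuadraticAlgebra.lift ⟨theta s b, theta_sq hD⟩

lemma emb_apply (hD : b ^ 2 + 4 * s < 0) (x : KK s b) : emb hD x = (x.re : ℂ) + x.im * theta s b := by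
  simp [emb, QuadraticAlgebra.lift, Algebra.smul_def]
  rfl

noncomputable def KKqd (hD : b ^ 2 + 4 * s < 0) : QD (𝓞 (KK s b)) where
  rank := by
    rw [RingOfIntegers.rank]
    exact QuadraticAlgebra.finrank_eq_two _ _
  φ := (emb hD : KK s b →+* ℂ).comp cc
  nrm := fun α => by
    have h2 := rt_sq hD
    have h1 := congrArg (Rat.cast : ℚ → ℝ) (norm_int α)
    rw [Rat.cast_intCast] at h1
    rw [h1]
    simp only [RingHom.comp_apply, RingHom.coe_coe]
    rw [emb_apply, Complex.normSq_apply]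
    simp [theta]
    linear_combination (-((cc α).im : ℝ) ^ 2 / 4) * h2
  om := ww s b
  im := by
    have h : ((b : ℝ) ^ 2 + 4 * s) < 0 := by exact_mod_cast hD
    simp only [RingHom.comp_apply, RingHom.coe_coe]
    rw [emb_apply, ww_coe]
    simp [theta]
    rw [rt, Real.sqrt_eq_zero']
    linarith
end KK
end Weber


namespace Weber
set_option linter.unusedSectionVars false
open QuadraticAlgebra NumberField

section key
variable {s b a c : ℤ} [Fact (∀ r : ℚ, r ^ 2 ≠ (s : ℚ) + b * r)]

/-- the ideal attached to the form -/
noncomputable def bb (s b a : ℤ) [Fact (∀ r : ℚ, r ^ 2 ≠ (s : ℚ) + b * r)] : Ideal (𝓞 (KK s b)) :=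
  Ideal.span {(a : 𝓞 (KK s b)), ww s b}

lemma bb_a : (a : 𝓞 (KK s b)) ∈ bb s b a := Ideal.subset_span (by simp)
lemma bb_w : ww s b ∈ bb s b a := Ideal.subset_span (by simp)

lemma bb_aux {R : Type*} [CommRing R] {s a b c u x y w : R} (hs : s = - (a * c)) (h2 : w * w = s + b * w)
    (h : x * a + y * w = u) : u * (b - w) = a * (x * (b - w) + c * y) := by
  subst hs
  linear_combination (-(b - w)) * h - y * h2

lemma bb_int (hs : s = - (a * c)) (hab : IsCoprime a b) {u : ℤ} (hu : (u : 𝓞 (KK s b)) ∈ bb s b a) : a ∣ u := by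
  obtain ⟨x, y, h⟩ := Ideal.mem_span_pair.mp hu
  -- multiply by the conjugate
  have h2 := ww_sq (s := s) (b := b)
  have hs' : (s : 𝓞 (KK s b)) = - (a * c) := by exact_mod_cast congrArg (Int.cast : ℤ → 𝓞 (KK s b)) hs
  have e : (u : 𝓞 (KK s b)) * (b - ww s b) = a * (x * (b - ww s b) + c * y) := bb_aux hs' h2 h
  obtain ⟨T, hT⟩ := trace_int' (x * ((b : 𝓞 (KK s b)) - ww s b) + (c : 𝓞 (KK s b)) * y)
  generalize (x * ((b : 𝓞 (KK s b)) - ww s b) + (c : 𝓞 (KK s b)) * y) = z at e hT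
  have e2 := congrArg cc e
  rw [map_mul, map_mul, map_sub, ww_coe, map_intCast, map_intCast, map_intCast] at e2
  have e3 := congrArg QuadraticAlgebra.re e2
  have e4 := congrArg QuadraticAlgebra.im e2
  simp at e3 e4
  have e5 : ((u * b : ℤ) : ℚ) = ((a * T : ℤ) : ℚ) := by
    push_cast
    rw [← hT]
    linear_combination 2 * e3 + b * e4
  have e6 : u * b = a * T := by exact_mod_cast e5
  exact hab.dvd_of_dvd_mul_right ⟨T, e6⟩

lemma bb_norm (hs : s = - (a * c)) (ha : 0 < a) (hcop : IsCoprime a (b ^ 2 + 4 * s)) (hab : IsCoprime a b) :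
    (Ideal.absNorm (bb s b a) : ℤ) = a := by
  let f : ℤ →+* 𝓞 (KK s b) ⧸ bb s b a := Int.castRingHom _
  have hf : ∀ n : ℤ, f n = Ideal.Quotient.mk _ (n : 𝓞 (KK s b)) := fun n => by simp [f]
  have hker : RingHom.ker f = Ideal.span {a} := by
    ext n
    rw [RingHom.mem_ker, hf, Ideal.Quotient.eq_zero_iff_mem, Ideal.mem_span_singleton]
    constructor
    · exact bb_int hs hab
    · rintro ⟨k, rfl⟩
      rw [Int.cast_mul]
      exact Ideal.mul_mem_right _ _ bb_a
  have hsurj : Function.Surjective f := by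
    intro z
    obtain ⟨x, rfl⟩ := Ideal.Quotient.mk_surjective z
    obtain ⟨u, v, h, -, -⟩ := disc_mul x
    obtain ⟨g, e, hge⟩ := hcop
    refine ⟨e * u, ?_⟩
    rw [hf, Ideal.Quotient.eq]
    have hge' : (g : 𝓞 (KK s b)) * a + e * ((b ^ 2 + 4 * s : ℤ) : 𝓞 (KK s b)) = 1 := by exact_mod_cast hge
    have : ((e * u : ℤ) : 𝓞 (KK s b)) - x = (-e * v) * ww s b - (g * x) * a := by
      push_cast at hge' h ⊢
      linear_combination x * hge' - e * h
    rw [this]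
    exact Ideal.sub_mem _ (Ideal.mul_mem_left _ _ bb_w) (Ideal.mul_mem_left _ _ bb_a)
  have e := RingHom.quotientKerEquivOfSurjective hsurj
  have hc : Ideal.absNorm (bb s b a) = Nat.card (ℤ ⧸ RingHom.ker f) := by
    rw [Ideal.absNorm_apply, Submodule.cardQuot_apply]
    exact (Nat.card_congr e.toEquiv).symm
  have hc2 : Nat.card (ℤ ⧸ RingHom.ker f) = Ideal.absNorm (RingHom.ker f) := rfl
  rw [hc, hc2, hker, Ideal.absNorm_span_singleton, Algebra.norm_self]
  simp [ha.le]

end key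

theorem key_cop (a b c : ℤ) (hD : b ^ 2 - 4 * a * c < 0) (ha : 0 < a) (ha4 : a % 4 = 1)
    (hcop : IsCoprime a (b ^ 2 - 4 * a * c)) :
    ∃ x y : ℤ, ∃ p : ℕ, p.Prime ∧ p % 4 = 1 ∧ a * x ^ 2 + b * x * y + c * y ^ 2 = p := by
  obtain ⟨s, hs⟩ : ∃ s : ℤ, s = - (a * c) := ⟨_, rfl⟩
  have hDs : b ^ 2 - 4 * a * c = b ^ 2 + 4 * s := by rw [hs]; ring
  rw [hDs] at hD hcop
  have := KK_fact hD
  have hab : IsCoprime a b := by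
    obtain ⟨g, e, h⟩ := hcop
    exact ⟨g - 4 * e * c, e * b, by rw [← h, hs]; ring⟩
  obtain ⟨m, hm⟩ : ∃ m : ℕ, m = 4 * (b ^ 2 + 4 * s).natAbs := ⟨_, rfl⟩
  have hmz : (m : ℤ) = - (4 * (b ^ 2 + 4 * s)) := by rw [hm]; push_cast; rw [abs_of_neg hD]; ring
  have hm3 : 3 ≤ m := by omega
  have ham : IsCoprime a (m : ℤ) := by
    rw [hmz, IsCoprime.neg_right_iff]
    refine IsCoprime.mul_right ?_ hcop
    exact ⟨1 , -(a / 4), by omega⟩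
  have hb : bb s b a ∈ cop (Ideal.span {(m : 𝓞 (KK s b))}) := by
    change IsCoprime _ _
    rw [Ideal.isCoprime_iff_exists]
    obtain ⟨g, e, h⟩ := ham
    refine ⟨g * a, Ideal.mul_mem_left _ _ bb_a, e * m, Ideal.mul_mem_left _ _ (Ideal.mem_span_singleton_self _), ?_⟩
    exact_mod_cast congrArg (Int.cast : ℤ → 𝓞 (KK s b)) h
  obtain ⟨𝔭, α, hp, hα, hm1⟩ := (KKqd hD).ray_prime hm3 (bb s b a) hb
  obtain ⟨η, hη⟩ := Ideal.mem_span_singleton.mp hα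
  obtain ⟨u, v, -, hu, hv⟩ := disc_mul η
  have hmO : (m : 𝓞 (KK s b)) = ((m : ℤ) : 𝓞 (KK s b)) := by simp
  have hα' : cc α = (⟨((1 - 4 * u : ℤ) : ℚ), ((-4 * v : ℤ) : ℚ)⟩ : KK s b) := by
    have h1 : α = 1 + ((m : ℤ) : 𝓞 (KK s b)) * η := by rw [← hmO, ← hη]; ring
    rw [h1, map_add, map_one, map_mul, map_intCast, hmz]
    have h3 : (((-(4 * (b ^ 2 + 4 * s)) : ℤ)) : KK s b) = ⟨((-(4 * (b ^ 2 + 4 * s)) : ℤ) : ℚ), 0⟩ := rfl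
    rw [h3]
    push_cast at hu hv
    ext
    · simp
      rw [← hu]; ring
    · simp
      rw [← hv]; ring
  have hN := norm_int α
  rw [hα'] at hN
  dsimp only at hN
  have hN2 : Algebra.norm ℤ α = (1 - 4 * u) ^ 2 + b * (1 - 4 * u) * (-4 * v) - s * (-4 * v) ^ 2 := by
    exact_mod_cast hN
  have hau : a ∣ 1 - 4 * u := by
    apply bb_int hs hab
    have h1 : ((1 - 4 * u : ℤ) : 𝓞 (KK s b)) = α - ((-4 * v : ℤ) : 𝓞 (KK s b)) * ww s b := by
      apply cc_inj
      rw [map_sub, map_mul, hα', ww_coe, map_intCast, map_intCast]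
      generalize 1 - 4 * u = u'
      generalize -4 * v = v'
      ext <;> simp
    rw [h1]
    refine Ideal.sub_mem _ ?_ (Ideal.mul_mem_left _ _ bb_w)
    have : α ∈ 𝔭 * bb s b a := by rw [hm1]; exact Ideal.mem_span_singleton_self α
    exact (Ideal.mul_le_right : 𝔭 * bb s b a ≤ bb s b a) this
  obtain ⟨x, hx⟩ := hau
  have hnn : 0 ≤ Algebra.norm ℤ α := by
    have h1 := (KKqd hD).nrm α
    have h2 : 0 ≤ ((Algebra.norm ℤ α : ℤ) : ℝ) := by rw [h1]; exact Complex.normSq_nonneg _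
    exact_mod_cast h2
  have hpn : (Ideal.absNorm 𝔭 : ℤ) * a = Algebra.norm ℤ α := by
    rw [← bb_norm hs ha hcop hab]
    have h1 := congrArg Ideal.absNorm hm1
    rw [map_mul, Ideal.absNorm_span_singleton] at h1
    have h2 := congrArg (Nat.cast : ℕ → ℤ) h1
    rw [Nat.cast_mul, Int.natCast_natAbs, abs_of_nonneg hnn] at h2
    exact h2
  refine ⟨x, -4 * v, Ideal.absNorm 𝔭, hp, ?_, ?_⟩
  · have h4 : (Ideal.absNorm 𝔭 : ℤ) * a = 1 + 4 * (- 2 * u + 4 * u ^ 2 - b * (1 - 4 * u) * v - 4 * s * v ^ 2) := by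
      rw [hpn, hN2]; ring
    generalize - 2 * u + 4 * u ^ 2 - b * (1 - 4 * u) * v - 4 * s * v ^ 2 = k at h4
    generalize Ideal.absNorm 𝔭 = P at h4
    have h5 : (P : ℤ) = 1 + 4 * (k - P * (a / 4)) := by
      have : a = 1 + 4 * (a / 4) := by omega
      rw [this] at h4
      have h6 : (1 + 4 * (a / 4)) / 4 = a / 4 := by omega
      linear_combination h4
    generalize k - P * (a / 4) = k' at h5
    omega
  · have h4 : a * (a * x ^ 2 + b * x * (-4 * v) + c * (-4 * v) ^ 2) = a * (Ideal.absNorm 𝔭 : ℤ) := by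
      rw [mul_comm a (Ideal.absNorm 𝔭 : ℤ), hpn, hN2, hx, hs]; ring
    exact mul_left_cancel₀ ha.ne' h4

end Weber


namespace Weber

lemma prime_dvd_prod_iff {S : Finset ℕ} (hS : ∀ r ∈ S, r.Prime) {p : ℕ} (hp : p.Prime) :
    p ∣ ∏ r ∈ S, r ↔ p ∈ S := by
  rw [Prime.dvd_finsetProd_iff hp.prime]
  constructor
  · rintro ⟨r, hr, h⟩
    rwa [(Nat.prime_dvd_prime_iff_eq hp (hS r hr)).mp h]
  · exact fun h => ⟨p, h, dvd_rfl⟩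

lemma isCoprime_of_primes {x y : ℤ} (h : ∀ p : ℕ, p.Prime → (p : ℤ) ∣ x → ¬ (p : ℤ) ∣ y) : IsCoprime x y := by
  rw [Int.isCoprime_iff_gcd_eq_one]
  by_contra hne
  obtain ⟨p, hp, hd⟩ := Nat.exists_prime_and_dvd hne
  have hd' : (p : ℤ) ∣ (Int.gcd x y : ℤ) := by exact_mod_cast hd
  exact h p hp (hd'.trans (Int.gcd_dvd_left x y)) (hd'.trans (Int.gcd_dvd_right x y))

theorem key_form (a b c : ℤ) (hD : b ^ 2 - 4 * a * c < 0) (ha : 0 < a) (ha4 : a % 4 = 1)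
    (hprim : ∀ p : ℕ, p.Prime → ¬ ((p : ℤ) ∣ a ∧ (p : ℤ) ∣ b ∧ (p : ℤ) ∣ c)) :
    ∃ x y : ℤ, ∃ p : ℕ, p.Prime ∧ p % 4 = 1 ∧ a * x ^ 2 + b * x * y + c * y ^ 2 = p := by
  classical
  obtain ⟨D, hDD⟩ : ∃ D, D = b ^ 2 - 4 * a * c := ⟨_, rfl⟩
  rw [← hDD] at hD
  have hD0 : D.natAbs ≠ 0 := by omega
  let S := D.natAbs.primeFactors
  have hS : ∀ r : ℕ, r.Prime → ((r : ℤ) ∣ D ↔ r ∈ S) := by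
    intro r hr
    rw [Nat.mem_primeFactors, Int.natCast_dvd]
    exact ⟨fun h => ⟨hr, h, hD0⟩, fun h => h.2.1⟩
  let x0 : ℕ := ∏ r ∈ S.filter (fun r : ℕ => (r : ℤ) ∣ a ∧ ¬ (r : ℤ) ∣ c), r
  let y1 : ℕ := ∏ r ∈ S.filter (fun r : ℕ => ¬ (r : ℤ) ∣ a), r
  have hx0 : ∀ r : ℕ, r.Prime → ((r : ℤ) ∣ (x0 : ℤ) ↔ (r : ℤ) ∣ D ∧ (r : ℤ) ∣ a ∧ ¬ (r : ℤ) ∣ c) := by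
    intro r hr
    rw [Int.natCast_dvd_natCast, hS r hr]
    exact (prime_dvd_prod_iff (fun r hr => Nat.prime_of_mem_primeFactors (Finset.mem_filter.mp hr).1) hr).trans Finset.mem_filter
  have hy1 : ∀ r : ℕ, r.Prime → ((r : ℤ) ∣ (y1 : ℤ) ↔ (r : ℤ) ∣ D ∧ ¬ (r : ℤ) ∣ a) := by
    intro r hr
    rw [Int.natCast_dvd_natCast, hS r hr]
    exact (prime_dvd_prod_iff (fun r hr => Nat.prime_of_mem_primeFactors (Finset.mem_filter.mp hr).1) hr).trans Finset.mem_filter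
  have h2a : ¬ ((2 : ℕ) : ℤ) ∣ a := by omega
  have hx2 : ¬ ((2 : ℕ) : ℤ) ∣ (x0 : ℤ) := fun h => h2a ((hx0 2 Nat.prime_two).mp h).2.1
  generalize (x0 : ℤ) = X at hx0 hx2
  generalize (y1 : ℤ) = Y at hy1
  have hp4 : ∀ r : ℕ, r.Prime → (r : ℤ) ∣ 4 * Y → r = 2 ∨ (r : ℤ) ∣ Y := by
    intro r hr h
    rcases (Nat.prime_iff_prime_int.mp hr).dvd_or_dvd h with h | h
    · left
      have h' : r ∣ 2 ^ 2 := by exact_mod_cast h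
      exact (Nat.prime_dvd_prime_iff_eq hr Nat.prime_two).mp (hr.dvd_of_dvd_pow h')
    · exact Or.inr h
  have hcopXY : IsCoprime X (4 * Y) := by
    apply isCoprime_of_primes
    intro r hr h1 h2
    rcases hp4 r hr h2 with rfl | h
    · exact hx2 h1
    · exact ((hy1 r hr).mp h).2 ((hx0 r hr).mp h1).2.1
  obtain ⟨A, hA⟩ : ∃ A, A = a * X ^ 2 + b * X * (4 * Y) + c * (4 * Y) ^ 2 := ⟨_, rfl⟩
  have hA4 : A % 4 = 1 := by
    have h1 : X ^ 2 % 4 = 1 := by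
      have : X % 4 = 1 ∨ X % 4 = 3 := by omega
      rcases this with h | h <;> simp [pow_two, Int.mul_emod, h]
    have h2 : A = a * X ^ 2 + 4 * (b * X * Y + 4 * c * Y ^ 2) := by rw [hA]; ring
    rw [h2, Int.add_mul_emod_self_left, Int.mul_emod, ha4, h1]; rfl
  have hApos : 0 < A := by
    have hX : X ≠ 0 := by rintro rfl; simp at hx2
    have h1 : 4 * a * A = (2 * a * X + b * (4 * Y)) ^ 2 - D * (4 * Y) ^ 2 := by rw [hA, hDD]; ring
    have h2 : 0 < 4 * a * A := by
      rw [h1]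
      by_cases hY : Y = 0
      · rw [hY]
        have : 0 < (2 * a * X) ^ 2 := by positivity
        simpa using this
      · have : 0 < (4 * Y) ^ 2 := by positivity
        nlinarith [sq_nonneg (2 * a * X + b * (4 * Y))]
    exact pos_of_mul_pos_right h2 (by positivity)
  have hAD : IsCoprime A D := by
    apply isCoprime_of_primes
    intro r hr h1 h2
    have hrp := Nat.prime_iff_prime_int.mp hr
    by_cases hr2 : r = 2
    · subst hr2; omega
    by_cases hra : (r : ℤ) ∣ a
    · by_cases hrc : (r : ℤ) ∣ c
      · -- b X times 4 Y
        have h3 : (r : ℤ) ∣ b * X * (4 * Y) := by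
          have : b * X * (4 * Y) = A - a * X ^ 2 - c * (4 * Y) ^ 2 := by rw [hA]; ring
          rw [this]
          exact dvd_sub (dvd_sub h1 (hra.mul_right _)) (hrc.mul_right _)
        rcases hrp.dvd_or_dvd h3 with h | h
        · rcases hrp.dvd_or_dvd h with h | h
          · exact hprim r hr ⟨hra, h, hrc⟩
          · exact ((hx0 r hr).mp h).2.2 hrc
        · rcases hp4 r hr h with h | h
          · exact hr2 h
          · exact ((hy1 r hr).mp h).2 hra
      · have hX := (hx0 r hr).mpr ⟨h2, hra, hrc⟩
        have h3 : (r : ℤ) ∣ c * (4 * Y) ^ 2 := by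
          have : c * (4 * Y) ^ 2 = A - X * (a * X + b * (4 * Y)) := by rw [hA]; ring
          rw [this]
          exact dvd_sub h1 (hX.mul_right _)
        rcases hrp.dvd_or_dvd h3 with h | h
        · exact hrc h
        · rcases hp4 r hr (hrp.dvd_of_dvd_pow h) with h | h
          · exact hr2 h
          · exact ((hy1 r hr).mp h).2 hra
    · have hY := (hy1 r hr).mpr ⟨h2, hra⟩
      have h3 : (r : ℤ) ∣ a * X ^ 2 := by
        have : a * X ^ 2 = A - Y * (4 * (b * X + c * (4 * Y))) := by rw [hA]; ring
        rw [this]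
        exact dvd_sub h1 (hY.mul_right _)
      rcases hrp.dvd_or_dvd h3 with h | h
      · exact hra h
      · exact hra ((hx0 r hr).mp (hrp.dvd_of_dvd_pow h)).2.1
  obtain ⟨w, z, hwz⟩ := hcopXY
  -- w X + z (4 Y) = 1
  have hdisc : (2 * a * X * (-z) + b * (X * w + 4 * Y * (-z)) + 2 * c * (4 * Y) * w) ^ 2
      - 4 * A * (a * (-z) ^ 2 + b * (-z) * w + c * w ^ 2) = D := by
    have : (2 * a * X * (-z) + b * (X * w + 4 * Y * (-z)) + 2 * c * (4 * Y) * w) ^ 2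
      - 4 * A * (a * (-z) ^ 2 + b * (-z) * w + c * w ^ 2) = D * (w * X + z * (4 * Y)) ^ 2 := by
      rw [hA, hDD]; ring
    rw [this, hwz]; ring
  obtain ⟨x, y, p, hp, hp4, h⟩ := key_cop A _ (a * (-z) ^ 2 + b * (-z) * w + c * w ^ 2)
    (by rw [hdisc]; exact hD) hApos hA4 (by rw [hdisc]; exact hAD)
  refine ⟨X * x + (-z) * y, 4 * Y * x + w * y, p, hp, hp4, ?_⟩
  rw [← h, hA]; ring

end Weber


namespace Weber

lemma mod_four_of_primes (d : ℕ) (h0 : d ≠ 0) (h : ∀ r : ℕ, r.Prime → r ∣ d → r % 4 = 1) : d % 4 = 1 := by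
  induction d using induction_on_primes with
  | zero => exact absurd rfl h0
  | one => rfl
  | prime_mul p a hp ih =>
    have h1 := h p hp (dvd_mul_right _ _)
    have h2 := ih (by rintro rfl; simp at h0) (fun r hr hd => h r hr (hd.mul_left _))
    rw [Nat.mul_mod, h1, h2]

lemma dvd_of_sum_sq {r : ℕ} (hr : r.Prime) (h3 : r % 4 = 3) {k l : ℤ} (h : (r : ℤ) ∣ k ^ 2 + l ^ 2) :
    (r : ℤ) ∣ k ∧ (r : ℤ) ∣ l := by
  haveI := Fact.mk hr
  have hz : ((k : ZMod r)) ^ 2 + (l : ZMod r) ^ 2 = 0 := by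
    have := (ZMod.intCast_zmod_eq_zero_iff_dvd (k ^ 2 + l ^ 2) r).mpr h
    exact_mod_cast this
  have hl : (l : ZMod r) = 0 := by
    by_contra hl
    exact ZMod.mod_four_ne_three_of_sq_eq_neg_sq' hl (x := (k : ZMod r)) (by linear_combination hz) h3
  have hk : (k : ZMod r) = 0 := by
    rw [hl] at hz
    simpa using hz
  exact ⟨(ZMod.intCast_zmod_eq_zero_iff_dvd k r).mp hk, (ZMod.intCast_zmod_eq_zero_iff_dvd l r).mp hl⟩

lemma quot_mod (k l m n : ℤ) (h d : ℕ) (t u a : ℤ) (ht : t ≠ 0) (hd : (h : ℤ) = t * d)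
    (hA : 2 * k ^ 2 + 2 * l ^ 2 = t * u ∨ 2 * m ^ 2 + 2 * n ^ 2 = t * u) (hu : u % 4 = 1) (hua : t * u = h * a)
    (h1 : (h : ℤ) ∣ 2 * k ^ 2 + 2 * l ^ 2) (h2 : (h : ℤ) ∣ 8 + 4 * k * m + 4 * l * n)
    (h3 : (h : ℤ) ∣ 2 * m ^ 2 + 2 * n ^ 2) : a % 4 = 1 := by
  have hud : u = d * a := by
    apply mul_left_cancel₀ ht
    rw [hua, hd]; ring
  have hd0 : d ≠ 0 := by
    rintro rfl
    simp at hud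
    omega
  have hd1 : d % 4 = 1 := by
    apply mod_four_of_primes d hd0
    intro r hr hrd
    have hrd' : (r : ℤ) ∣ d := by exact_mod_cast hrd
    have hru : (r : ℤ) ∣ u := hud ▸ hrd'.mul_right a
    have hrh : (r : ℤ) ∣ h := hd ▸ hrd'.mul_left t
    have hr2 : r ≠ 2 := by rintro rfl; omega
    have hodd := hr.eq_two_or_odd
    by_contra hne
    have hr3 : r % 4 = 3 := by omega
    have hp2 : ∀ z : ℤ, (r : ℤ) ∣ 2 * z → (r : ℤ) ∣ z := by
      intro z hz
      rcases (Nat.prime_iff_prime_int.mp hr).dvd_or_dvd hz with h | h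
      · have h' : r ∣ 2 := by exact_mod_cast h
        exact absurd ((Nat.prime_dvd_prime_iff_eq hr Nat.prime_two).mp h') hr2
      · exact h
    obtain ⟨hk, hl⟩ := dvd_of_sum_sq hr hr3 (hp2 _ (by simpa [mul_add] using hrh.trans h1) : (r : ℤ) ∣ k ^ 2 + l ^ 2)
    have h8 : (r : ℤ) ∣ 2 * (2 * (2 * 1)) := by
      have e : (2 * (2 * (2 * 1)) : ℤ) = (8 + 4 * k * m + 4 * l * n) - k * (4 * m) - l * (4 * n) := by ring
      rw [e]
      exact dvd_sub (dvd_sub (hrh.trans h2) (hk.mul_right _)) (hl.mul_right _)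
    have := hp2 _ (hp2 _ (hp2 _ h8))
    have h' : r ∣ 1 := by exact_mod_cast this
    exact hr.one_lt.ne' (Nat.dvd_one.mp h')
  have hd1' : (d : ℤ) % 4 = 1 := by omega
  rw [hud, Int.mul_emod, hd1'] at hu
  omega

lemma sq_mod (k : ℤ) : (k % 2 = 0 ∧ k ^ 2 % 4 = 0) ∨ (k % 2 = 1 ∧ k ^ 2 % 8 = 1) := by
  rcases Int.even_or_odd' k with ⟨j, rfl | rfl⟩
  · left
    refine ⟨by omega, ?_⟩
    have : (2 * j) ^ 2 = 4 * j ^ 2 := by ring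
    omega
  · right
    refine ⟨by omega, ?_⟩
    obtain ⟨i, hi⟩ := Int.even_mul_succ_self j
    have : (2 * j + 1) ^ 2 = 8 * i + 1 := by linear_combination 4 * hi
    omega

/-- the case where the first pair is good -/
lemma good_case (k l m n a : ℤ) (h : ℕ)
    (hgood : (k + l) % 2 = 1 ∨ (k % 2 = 1 ∧ l % 2 = 1 ∧ (m + n) % 2 = 0))
    (hua : 2 * k ^ 2 + 2 * l ^ 2 = h * a)
    (h1 : (h : ℤ) ∣ 2 * k ^ 2 + 2 * l ^ 2) (h2 : (h : ℤ) ∣ 8 + 4 * k * m + 4 * l * n)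
    (h3 : (h : ℤ) ∣ 2 * m ^ 2 + 2 * n ^ 2)
    (hmax : ∀ t : ℤ, t ∣ 2 * k ^ 2 + 2 * l ^ 2 → t ∣ 8 + 4 * k * m + 4 * l * n → t ∣ 2 * m ^ 2 + 2 * n ^ 2 → t ∣ h) :
    a % 4 = 1 := by
  rcases hgood with hg | ⟨hk, hl, hmn⟩
  · have h2h : (2 : ℤ) ∣ h := by
      apply hmax
      · exact ⟨k ^ 2 + l ^ 2, by ring⟩
      · exact ⟨4 + 2 * k * m + 2 * l * n, by ring⟩
      · exact ⟨m ^ 2 + n ^ 2, by ring⟩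
    obtain ⟨d, hd⟩ : ∃ d : ℕ, h = 2 * d := ⟨h / 2, by omega⟩
    refine quot_mod k l m n h d 2 (k ^ 2 + l ^ 2) a (by norm_num) (by exact_mod_cast hd) (Or.inl (by ring)) ?_ (by rw [← hua]; ring) h1 h2 h3
    have := sq_mod k
    have := sq_mod l
    omega
  · have hk2 := sq_mod k
    have hl2 := sq_mod l
    have hm2 := sq_mod m
    have hn2 := sq_mod n
    have h4h : (4 : ℤ) ∣ h := by
      apply hmax
      · omega
      · exact ⟨2 + k * m + l * n, by ring⟩
      · omega
    obtain ⟨d, hd⟩ : ∃ d : ℕ, h = 4 * d := ⟨h / 4, by omega⟩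
    obtain ⟨u, hu⟩ : ∃ u, 2 * k ^ 2 + 2 * l ^ 2 = 4 * u := ⟨(2 * k ^ 2 + 2 * l ^ 2) / 4, by omega⟩
    refine quot_mod k l m n h d 4 u a (by norm_num) (by exact_mod_cast hd) (Or.inl hu) ?_ (by rw [← hua, hu]) h1 h2 h3
    omega

end Weber

theorem stmt_4 (k l m n : ℤ)
    (hne : ¬ (Even k ∧ Even l ∧ Even m ∧ Even n))
    (Q : ℤ → ℤ → ℤ)
    (hQ : ∀ x y, Q x y = 2*(k*x + m*y)^2 + 2*(l*x + n*y)^2 + 8*x*y)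
    (hpos : ∀ x y : ℤ, (x, y) ≠ (0, 0) → 0 < Q x y)
    (h : ℕ)
    (hh : (h : ℤ) = Int.gcd (2*k^2 + 2*l^2)
      (Int.gcd (8 + 4*k*m + 4*l*n) (2*m^2 + 2*n^2))) :
    ∃ x y : ℤ, ∃ p : ℕ, p.Prime ∧ p % 4 = 1 ∧ Q x y = (h : ℤ) * p := by
  have h1 : (h : ℤ) ∣ 2 * k ^ 2 + 2 * l ^ 2 := by rw [hh]; exact Int.gcd_dvd_left _ _
  have h23 : (h : ℤ) ∣ (Int.gcd (8 + 4*k*m + 4*l*n) (2*m^2 + 2*n^2) : ℤ) := by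
    rw [hh]; exact Int.gcd_dvd_right _ _
  have h2 : (h : ℤ) ∣ 8 + 4 * k * m + 4 * l * n := h23.trans (Int.gcd_dvd_left _ _)
  have h3 : (h : ℤ) ∣ 2 * m ^ 2 + 2 * n ^ 2 := h23.trans (Int.gcd_dvd_right _ _)
  have hmax : ∀ t : ℤ, t ∣ 2 * k ^ 2 + 2 * l ^ 2 → t ∣ 8 + 4 * k * m + 4 * l * n →
      t ∣ 2 * m ^ 2 + 2 * n ^ 2 → t ∣ h := by
    intro t a b c
    rw [hh]
    exact Int.dvd_coe_gcd a (Int.dvd_coe_gcd b c)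
  have hA : 0 < 2 * k ^ 2 + 2 * l ^ 2 := by
    have := hpos 1 0 (by simp)
    rw [hQ] at this
    linarith
  have hC : 0 < 2 * m ^ 2 + 2 * n ^ 2 := by
    have := hpos 0 1 (by simp)
    rw [hQ] at this
    linarith
  have hdisc : (8 + 4 * k * m + 4 * l * n) ^ 2 - 4 * (2 * k ^ 2 + 2 * l ^ 2) * (2 * m ^ 2 + 2 * n ^ 2) < 0 := by
    have := hpos (8 + 4 * k * m + 4 * l * n) (-2 * (2 * k ^ 2 + 2 * l ^ 2)) (by
      intro e
      have := (Prod.mk.inj e).2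
      linarith)
    rw [hQ] at this
    by_contra hcon
    push Not at hcon
    have := mul_nonneg hA.le hcon
    nlinarith
  obtain ⟨a, ha⟩ := h1
  obtain ⟨b, hb⟩ := h2
  obtain ⟨c, hc⟩ := h3
  have hh0 : (0 : ℤ) < h := by
    rcases Nat.eq_zero_or_pos h with h0 | h0
    · rw [h0] at ha; simp at ha; omega
    · exact_mod_cast h0
  have ha0 : 0 < a := by
    rw [ha] at hA
    exact pos_of_mul_pos_right hA hh0.le
  have hc0 : 0 < c := by
    rw [hc] at hC
    exact pos_of_mul_pos_right hC hh0.le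
  have hD : b ^ 2 - 4 * a * c < 0 := by
    rw [ha, hb, hc] at hdisc
    have e : ((h : ℤ) * b) ^ 2 - 4 * (h * a) * (h * c) = h ^ 2 * (b ^ 2 - 4 * a * c) := by ring
    rw [e] at hdisc
    by_contra hcon
    push Not at hcon
    have := mul_nonneg (sq_nonneg (h : ℤ)) hcon
    linarith
  have hprim : ∀ p : ℕ, p.Prime → ¬ ((p : ℤ) ∣ a ∧ (p : ℤ) ∣ b ∧ (p : ℤ) ∣ c) := by
    rintro p hp ⟨pa, pb, pc⟩
    have hd : (h : ℤ) * p ∣ h * 1 := by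
      rw [mul_one]
      apply hmax
      · rw [ha]; exact mul_dvd_mul_left _ pa
      · rw [hb]; exact mul_dvd_mul_left _ pb
      · rw [hc]; exact mul_dvd_mul_left _ pc
    have h' : (p : ℤ) ∣ 1 := Int.dvd_of_mul_dvd_mul_left hh0.ne' hd
    have h'' : p ∣ 1 := by exact_mod_cast h'
    exact hp.one_lt.ne' (Nat.dvd_one.mp h'')
  have hQ' : ∀ x y, Q x y = h * (a * x ^ 2 + b * x * y + c * y ^ 2) := by
    intro x y
    rw [hQ]
    linear_combination x ^ 2 * ha + x * y * hb + y ^ 2 * hc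
  have hcase : a % 4 = 1 ∨ c % 4 = 1 := by
    simp only [Int.even_iff] at hne
    have hg : ((k + l) % 2 = 1 ∨ (k % 2 = 1 ∧ l % 2 = 1 ∧ (m + n) % 2 = 0)) ∨
        ((m + n) % 2 = 1 ∨ (m % 2 = 1 ∧ n % 2 = 1 ∧ (k + l) % 2 = 0)) := by omega
    rcases hg with hg | hg
    · left
      exact Weber.good_case k l m n a h hg ha ⟨_, ha⟩ ⟨_, hb⟩ ⟨_, hc⟩ hmax
    · right
      have e : 8 + 4 * m * k + 4 * n * l = 8 + 4 * k * m + 4 * l * n := by ring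
      exact Weber.good_case m n k l c h hg hc ⟨_, hc⟩ (e ▸ ⟨_, hb⟩) ⟨_, ha⟩
        (fun t x y z => hmax t z (e ▸ y) x)
  rcases hcase with h4 | h4
  · obtain ⟨x, y, p, hp, hp4, e⟩ := Weber.key_form a b c hD ha0 h4 hprim
    exact ⟨x, y, p, hp, hp4, by rw [hQ', e]⟩
  · obtain ⟨x, y, p, hp, hp4, e⟩ := Weber.key_form c b a (by linarith) hc0 h4
      (fun p hp hd => hprim p hp ⟨hd.2.2, hd.2.1, hd.1⟩)
    exact ⟨y, x, p, hp, hp4, by rw [hQ', ← e]; ring⟩
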